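/- arXiv:1501.01119 — 10 statements merged into one kernel-verified Lean document; each statement's English description precedes it below -/
import Mathlib

section
/- Let φ : ℝ → ℝ be convex and nonnegative on the interval (0,∞) and let ν ∈ ℕ with ν ≥ 1. Then the (possibly infinite) sum ∑_{k=ν}^{∞} φ(k) is at most the (possibly infinite) improper integral ∫_{ν−1/2}^{∞} φ(x) dx, as an inequality in the extended nonnegative reals. -/
open scoped ENNReal

open MeasureTheory Set in
/-- Midpoint half of the Hermite–Hadamard inequality. -/
theorem ConvexOn.sub_mul_midpoint_le_integral {f : ℝ → ℝ} {a b : ℝ} (hab : a < b)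
    (hf : ConvexOn ℝ (Icc a b) f) (hcont : ContinuousOn f (Icc a b)) :
    (b - a) * f ((a + b) / 2) ≤ ∫ x in a..b, f x := by
  have hba : 0 < b - a := sub_pos.2 hab
  have hjensen := hf.map_set_average_le (μ := volume) (t := Ioc a b) (f := id) hcont isClosed_Icc
    (by simp [hab]) (by simp)
    ((ae_restrict_iff' measurableSet_Ioc).2 (ae_of_all _ fun x hx ↦ Ioc_subset_Icc_self hx))
    (continuousOn_id.integrableOn_Icc.mono_set Ioc_subset_Icc_self)
    (hcont.integrableOn_Icc.mono_set Ioc_subset_Icc_self)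
  rw [← uIoc_of_le hab.le] at hjensen
  simp only [interval_average_eq_div, id, integral_id] at hjensen
  rw [le_div_iff₀ hba] at hjensen
  have hmid : (b ^ 2 - a ^ 2) / 2 / (b - a) = (a + b) / 2 := by
    field_simp
    ring
  rwa [hmid, mul_comm] at hjensen

open MeasureTheory Set in
/-- A nonnegative convex function on `(0, ∞)` is bounded at `c` by its integral over the unit
interval centred at `c`. -/
theorem ConvexOn.ofReal_le_setLIntegral_Ioc {φ : ℝ → ℝ} (hφ : ConvexOn ℝ (Ioi (0 : ℝ)) φ)
    (hnonneg : ∀ x ∈ Ioi (0 : ℝ), 0 ≤ φ x) {c : ℝ} (hc : 1 / 2 < c) :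
    ENNReal.ofReal (φ c) ≤ ∫⁻ x in Ioc (c - 1 / 2) (c + 1 / 2), ENNReal.ofReal (φ x) := by
  have hsub : Icc (c - 1 / 2) (c + 1 / 2) ⊆ Ioi 0 := fun x hx ↦ by
    simp only [mem_Icc, mem_Ioi] at *
    linarith
  have hcont := (hφ.continuousOn isOpen_Ioi).mono hsub
  have hmid := (hφ.subset hsub (convex_Icc _ _)).sub_mul_midpoint_le_integral
    (by linarith) hcont
  rw [intervalIntegral.integral_of_le (by linarith)] at hmid
  rw [← ofReal_integral_eq_lintegral_ofReal
    (hcont.integrableOn_Icc.mono_set Ioc_subset_Icc_self)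
    ((ae_restrict_iff' measurableSet_Ioc).2
      (ae_of_all _ fun x hx ↦ hnonneg x (hsub (Ioc_subset_Icc_self hx))))]
  refine ENNReal.ofReal_le_ofReal ?_
  ring_nf at hmid ⊢
  exact hmid

/-- **Lemma (sum vs. integral for convex functions, infinite case).**
If `φ : ℝ → ℝ` is convex and nonnegative on `(0, ∞)` and `ν ≥ 1`, then
`∑_{k=ν}^{∞} φ(k) ≤ ∫_{ν - 1/2}^{∞} φ(x) dx`, as an inequality in `[0, ∞]`. -/
theorem tsum_le_lintegral_of_convexOn (φ : ℝ → ℝ)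
    (hconv : ConvexOn ℝ (Set.Ioi (0 : ℝ)) φ)
    (hnonneg : ∀ x ∈ Set.Ioi (0 : ℝ), 0 ≤ φ x)
    (ν : ℕ) (hν : 1 ≤ ν) :
    ∑' k : {k : ℕ // ν ≤ k}, ENNReal.ofReal (φ (k.1 : ℝ)) ≤
      ∫⁻ x in Set.Ioi ((ν : ℝ) - 1/2), ENNReal.ofReal (φ x) := by
  have hdisj : Pairwise (Function.onFun Disjoint fun k : {k : ℕ // ν ≤ k} ↦
      Set.Ioc ((k.1 : ℝ) - 1 / 2) (k.1 + 1 / 2)) := by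
    intro j k hjk
    refine Set.disjoint_left.2 fun x hj hk ↦ hjk (Subtype.ext ?_)
    have hjk_lt : (j.1 : ℝ) < k.1 + 1 := by linarith [hj.1, hk.2]
    have hkj_lt : (k.1 : ℝ) < j.1 + 1 := by linarith [hk.1, hj.2]
    norm_cast at hjk_lt hkj_lt
    omega
  calc ∑' k : {k : ℕ // ν ≤ k}, ENNReal.ofReal (φ (k.1 : ℝ))
      ≤ ∑' k : {k : ℕ // ν ≤ k},
          ∫⁻ x in Set.Ioc ((k.1 : ℝ) - 1 / 2) (k.1 + 1 / 2), ENNReal.ofReal (φ x) := by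
        refine ENNReal.tsum_le_tsum fun k ↦
          hconv.ofReal_le_setLIntegral_Ioc hnonneg ?_
        have hk : (1 : ℝ) ≤ k.1 := mod_cast hν.trans k.2
        linarith
    _ = ∫⁻ x in ⋃ k : {k : ℕ // ν ≤ k}, Set.Ioc ((k.1 : ℝ) - 1 / 2) (k.1 + 1 / 2),
          ENNReal.ofReal (φ x) :=
        (MeasureTheory.lintegral_iUnion (fun _ ↦ measurableSet_Ioc) hdisj _).symm
    _ ≤ ∫⁻ x in Set.Ioi ((ν : ℝ) - 1/2), ENNReal.ofReal (φ x) := by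
        refine MeasureTheory.lintegral_mono_set (Set.iUnion_subset fun k x hx ↦ ?_)
        have hk : (ν : ℝ) ≤ k.1 := mod_cast k.2
        exact lt_of_le_of_lt (by linarith) hx.1
end

section
/- Let m ∈ ℕ with m ≥ 1 and let T ≥ 1 be a real number. Then the set Γ(T) := { l ∈ ℕ_{≥1}^m : ∏_{j=1}^m l_j ≤ T } is finite and its cardinality satisfies |Γ(T)| ≤ (2^m / (m−1)!) · T · (log T + m log 2)^{m−1}. -/
/-- The finite-dimensional hyperbolic cross `Γ(T)`: all `m`-tuples of positive
integers whose product is at most `T`. -/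
def GammaSet (m : ℕ) (T : ℝ) : Set (Fin m → ℕ) :=
  {l | (∀ j, 1 ≤ l j) ∧ (∏ j, (l j : ℝ)) ≤ T}

/-- Bernoulli's inequality in homogeneous form. -/
lemma pow_succ_add_le_add_pow_succ {y d : ℝ} (hy : 0 ≤ y) (hd : 0 ≤ d) (n : ℕ) :
    y ^ (n + 1) + (n + 1) * d * y ^ n ≤ (y + d) ^ (n + 1) := by
  induction n with
  | zero => simp
  | succ n ih =>
    have h := mul_le_mul_of_nonneg_right ih (add_nonneg hy hd)
    have h' : 0 ≤ ((n : ℝ) + 1) * d * d * y ^ n := by positivity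
    rw [pow_succ (y + d)]
    push_cast
    linear_combination h + h'

/-- Telescoped comparison of `∑ (a - log k) ^ m / k` with the corresponding integral. -/
lemma sum_sub_log_pow_div_le (m : ℕ) (a : ℝ) (n : ℕ) (hn : Real.log ((n : ℝ) + 1) ≤ a) :
    ∑ k ∈ Finset.Icc 1 (n + 1), (a - Real.log k) ^ m / k ≤
      a ^ m + (a ^ (m + 1) - (a - Real.log ((n : ℝ) + 1)) ^ (m + 1)) / (m + 1) := by
  induction n with
  | zero => simp
  | succ n ih =>
    have hlog : Real.log ((n : ℝ) + 1) ≤ Real.log ((n : ℝ) + 1 + 1) :=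
      Real.log_le_log (by positivity) (by linarith)
    push_cast at hn
    have hstep : 1 / ((n : ℝ) + 1 + 1) ≤
        Real.log ((n : ℝ) + 1 + 1) - Real.log ((n : ℝ) + 1) := by
      have h := Real.one_sub_inv_le_log_of_pos
        (show 0 < ((n : ℝ) + 1 + 1) / ((n : ℝ) + 1) by positivity)
      rw [Real.log_div (by positivity) (by positivity)] at h
      refine le_trans (le_of_eq ?_) h
      field_simp
      ring
    have hbern := pow_succ_add_le_add_pow_succ (sub_nonneg.2 hn) (sub_nonneg.2 hlog) m
    rw [sub_add_sub_cancel] at hbern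
    have hpow : 0 ≤ (a - Real.log ((n : ℝ) + 1 + 1)) ^ m := pow_nonneg (sub_nonneg.2 hn) m
    have hterm : (a - Real.log ((n : ℝ) + 1 + 1)) ^ m / ((n : ℝ) + 1 + 1) ≤
        ((a - Real.log ((n : ℝ) + 1)) ^ (m + 1) -
          (a - Real.log ((n : ℝ) + 1 + 1)) ^ (m + 1)) / (m + 1) := by
      rw [le_div_iff₀ (by positivity)]
      have h := mul_le_mul_of_nonneg_left hstep
        (mul_nonneg (by positivity : (0 : ℝ) ≤ m + 1) hpow)
      calc _ = ((m : ℝ) + 1) * (a - Real.log ((n : ℝ) + 1 + 1)) ^ m *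
            (1 / ((n : ℝ) + 1 + 1)) := by ring
        _ ≤ _ := h
        _ ≤ _ := by linear_combination hbern
    rw [Finset.sum_Icc_succ_top (by omega)]
    push_cast
    have ih' := ih (hlog.trans hn)
    calc _ ≤ _ := add_le_add ih' hterm
      _ = _ := by ring

lemma sum_sub_log_pow_div_floor_le (m : ℕ) {T c : ℝ} (hT : 1 ≤ T) (hc : 0 ≤ c) :
    ∑ k ∈ Finset.Icc 1 ⌊T⌋₊, (Real.log T + c - Real.log k) ^ m / k ≤
      (Real.log T + c) ^ m + (Real.log T + c) ^ (m + 1) / (m + 1) := by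
  obtain ⟨n, hn⟩ := Nat.exists_eq_succ_of_ne_zero (Nat.floor_pos.2 hT).ne'
  have hle : (n : ℝ) + 1 ≤ T := by
    have h := Nat.floor_le (zero_le_one.trans hT)
    rw [hn] at h
    exact_mod_cast h
  have hlog : Real.log ((n : ℝ) + 1) ≤ Real.log T + c :=
    (Real.log_le_log (by positivity) hle).trans (le_add_of_nonneg_right hc)
  rw [hn]
  refine (sum_sub_log_pow_div_le m _ n hlog).trans ?_
  gcongr
  exact sub_le_self _ (pow_nonneg (sub_nonneg.2 hlog) _)

lemma GammaSet_succ_subset (m : ℕ) (T : ℝ) :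
    GammaSet (m + 1) T ⊆
      ⋃ k ∈ Finset.Icc 1 ⌊T⌋₊, Set.image (Fin.cons (α := fun _ => ℕ) k) (GammaSet m (T / k)) := by
  rintro l ⟨hpos, hprod⟩
  rw [Fin.prod_univ_succ] at hprod
  have hhead : (0 : ℝ) < l 0 := by exact_mod_cast hpos 0
  have htail : (1 : ℝ) ≤ ∏ j : Fin m, (l j.succ : ℝ) := by
    exact_mod_cast Finset.one_le_prod' (fun j _ => hpos (Fin.succ j))
  refine Set.mem_biUnion (x := l 0) ?_ ⟨Fin.tail l, ⟨fun j => hpos j.succ, ?_⟩,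
    Fin.cons_self_tail l⟩
  · exact Finset.mem_coe.2 (Finset.mem_Icc.2 ⟨hpos 0, Nat.le_floor
      ((le_mul_of_one_le_right hhead.le htail).trans hprod)⟩)
  · rw [le_div_iff₀ hhead, mul_comm]
    exact hprod

lemma finite_GammaSet (m : ℕ) (T : ℝ) : (GammaSet m T).Finite := by
  induction m generalizing T with
  | zero => exact Set.toFinite _
  | succ m ih =>
    exact (Set.Finite.biUnion (Finset.finite_toSet _) fun _ _ => (ih _).image _).subset
      (GammaSet_succ_subset m T)

lemma ncard_GammaSet_succ_le (m : ℕ) (T : ℝ) :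
    (GammaSet (m + 1) T).ncard ≤ ∑ k ∈ Finset.Icc 1 ⌊T⌋₊, (GammaSet m (T / k)).ncard :=
  calc _ ≤ _ := Set.ncard_le_ncard (GammaSet_succ_subset m T)
        (Set.Finite.biUnion (Finset.finite_toSet _) fun _ _ => (finite_GammaSet m _).image _)
    _ ≤ _ := Finset.set_ncard_biUnion_le _ _
    _ ≤ _ := Finset.sum_le_sum fun _ _ => Set.ncard_image_le (finite_GammaSet m _)

lemma ncard_GammaSet_succ_le_log_pow (m : ℕ) {T : ℝ} (hT : 1 ≤ T) :
    ((GammaSet (m + 1) T).ncard : ℝ) ≤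
      2 ^ (m + 1) / m.factorial * T * (Real.log T + (m + 1) * Real.log 2) ^ m := by
  induction m generalizing T with
  | zero =>
    have h : (GammaSet 1 T).ncard ≤ ⌊T⌋₊ :=
      (ncard_GammaSet_succ_le 0 T).trans <|
        (Finset.sum_le_card_nsmul _ _ 1 fun _ _ => Set.ncard_le_one_of_subsingleton _).trans
          (by simp)
    have h' : ((GammaSet 1 T).ncard : ℝ) ≤ T :=
      (Nat.cast_le.2 h).trans (Nat.floor_le (by linarith))
    simpa using h'.trans (by linarith : T ≤ 2 * T)
  | succ m ih =>
    have hlog2 : 0 < Real.log 2 := Real.log_pos one_lt_two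
    have hlogT : 0 ≤ Real.log T := Real.log_nonneg hT
    set c : ℝ := (m + 1) * Real.log 2 with hc
    have hc0 : 0 ≤ c := by positivity
    have hterm : ∀ k ∈ Finset.Icc 1 ⌊T⌋₊, ((GammaSet (m + 1) (T / k)).ncard : ℝ) ≤
        2 ^ (m + 1) / m.factorial * T * ((Real.log T + c - Real.log k) ^ m / k) := by
      intro k hk
      obtain ⟨hk1, hkT⟩ := Finset.mem_Icc.1 hk
      have hk0 : (0 : ℝ) < k := by exact_mod_cast hk1
      have hkT' : (k : ℝ) ≤ T := (Nat.le_floor_iff (by linarith)).1 hkT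
      refine (ih ((one_le_div hk0).2 hkT')).trans (le_of_eq ?_)
      rw [Real.log_div (by positivity) hk0.ne', sub_add_eq_add_sub]
      ring
    have hbern := pow_succ_add_le_add_pow_succ (add_nonneg hlogT hc0) hlog2.le m
    have hpow : 0 ≤ (Real.log T + c) ^ m := by positivity
    have hpow' : 0 ≤ (Real.log T + c) ^ (m + 1) := by positivity
    have hmain : (Real.log T + c) ^ m + (Real.log T + c) ^ (m + 1) / (m + 1) ≤
        2 / (m + 1) * (Real.log T + c + Real.log 2) ^ (m + 1) := by
      have h2 : 1 ≤ 2 * Real.log 2 := by linarith [Real.log_two_gt_d9]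
      have h3 := mul_le_mul_of_nonneg_left h2 (mul_nonneg (by positivity : (0 : ℝ) ≤ m + 1) hpow)
      rw [div_mul_eq_mul_div, le_div_iff₀ (by positivity), add_mul,
        div_mul_cancel₀ _ (by positivity)]
      linear_combination 2 * hbern + h3 + hpow'
    calc ((GammaSet (m + 1 + 1) T).ncard : ℝ)
        ≤ ∑ k ∈ Finset.Icc 1 ⌊T⌋₊, ((GammaSet (m + 1) (T / k)).ncard : ℝ) := by
          exact_mod_cast ncard_GammaSet_succ_le (m + 1) T
      _ ≤ 2 ^ (m + 1) / m.factorial * T *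
            ∑ k ∈ Finset.Icc 1 ⌊T⌋₊, (Real.log T + c - Real.log k) ^ m / k := by
          rw [Finset.mul_sum]
          exact Finset.sum_le_sum hterm
      _ ≤ 2 ^ (m + 1) / m.factorial * T *
            (2 / (m + 1) * (Real.log T + c + Real.log 2) ^ (m + 1)) := by
          gcongr
          exact (sum_sub_log_pow_div_floor_le m hT hc0).trans hmain
      _ = _ := by
          rw [Nat.factorial_succ, show Real.log T + ((m + 1 : ℕ) + 1) * Real.log 2 =
            Real.log T + c + Real.log 2 by rw [hc]; push_cast; ring]
          push_cast
          field_simp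
          ring

/-- **Lemma.** For `m ≥ 1` and `T ≥ 1`, the set `Γ(T)` is finite and
`|Γ(T)| ≤ (2^m / (m-1)!) · T · (log T + m log 2)^{m-1}`. -/
theorem card_GammaSet_le (m : ℕ) (hm : 1 ≤ m) (T : ℝ) (hT : 1 ≤ T) :
    (GammaSet m T).Finite ∧
    (Nat.card (GammaSet m T) : ℝ) ≤
      2 ^ m / (m - 1).factorial * T * (Real.log T + m * Real.log 2) ^ (m - 1) := by
  refine ⟨finite_GammaSet m T, ?_⟩
  obtain ⟨n, rfl⟩ := Nat.exists_eq_add_of_le' hm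
  rw [Nat.card_coe_set_eq]
  simpa using ncard_GammaSet_succ_le_log_pow n hT
end

section
/- Let m ∈ ℕ with m ≥ 1, a > 0, and let r = (r_j)_{j≥1} be a sequence of positive reals such that M_{0}(m) := ∑_{j=1}^{∞} 1/(e^{m r_j / a} − 1) < ∞. Then for every real T ≥ 1 the set E(T) := { (k,s) ∈ ℤ_+^m × ℤ_+^∞, s finitely supported : max_{1≤j≤m}(1+k_j)^a · exp(∑_{j=1}^{∞} r_j s_j) ≤ T } is finite and |E(T)| ≤ (3/2)^{2m} · exp(M_{0}(m)) · T^{m/a}. -/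
/-- The analytic-type hyperbolic cross (with polynomial-prefactor parameter `p = 0`):
`E(T) = { (k,s) : max_{1≤j≤m}(1+k_j)^a · exp(∑_j r_j s_j) ≤ T }`, where `k ∈ ℤ_+^m`
and `s ∈ ℤ_+^∞` is finitely supported. -/
noncomputable def EsetZero (m : ℕ) (a : ℝ) (r : ℕ → ℝ) (T : ℝ) :
    Set ((Fin m → ℕ) × (ℕ →₀ ℕ)) :=
  {p | ((Finset.univ.sup (fun j => 1 + p.1 j) : ℕ) : ℝ) ^ a *
        Real.exp (p.2.sum fun j c => r j * c) ≤ T}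

open Finset in
/-- The number of `k ∈ ℕ^m` with `max_j (1 + k_j)^a ≤ U` is at most `U^{m/a}`. -/
lemma card_le_rpow_of_forall_sup_rpow_le {m : ℕ} {a U : ℝ} (ha : 0 < a) (hU : 0 ≤ U)
    (K : Finset (Fin m → ℕ))
    (hK : ∀ k ∈ K, ((univ.sup (fun j => 1 + k j) : ℕ) : ℝ) ^ a ≤ U) :
    (K.card : ℝ) ≤ U ^ ((m : ℝ) / a) := by
  have hy : 0 ≤ U ^ a⁻¹ := Real.rpow_nonneg hU _
  have hsub : K ⊆ Fintype.piFinset fun _ : Fin m => range ⌊U ^ a⁻¹⌋₊ := by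
    intro k hk
    rw [Fintype.mem_piFinset]
    intro j
    rw [mem_range, ← Nat.succ_le_iff, Nat.le_floor_iff hy]
    have hj : k j + 1 ≤ univ.sup fun j => 1 + k j := by
      rw [add_comm]
      exact le_sup (f := fun j => 1 + k j) (mem_univ j)
    refine le_trans (Nat.cast_le.mpr hj) ?_
    exact (Real.le_rpow_inv_iff_of_pos (Nat.cast_nonneg _) hU ha).mpr (hK k hk)
  have hcard : K.card ≤ ⌊U ^ a⁻¹⌋₊ ^ m := by
    simpa using card_le_card hsub
  calc (K.card : ℝ) ≤ (⌊U ^ a⁻¹⌋₊ : ℝ) ^ m := by exact_mod_cast hcard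
    _ ≤ (U ^ a⁻¹) ^ m := by
      gcongr
      exact Nat.floor_le hy
    _ = U ^ ((m : ℝ) / a) := by
      rw [← Real.rpow_natCast, ← Real.rpow_mul hU, div_eq_inv_mul]

open Finset in
/-- A finite part of the expansion of the Euler-type product `∏_j (1 - e^{-b_j})⁻¹` is bounded by
`exp (∑_j 1 / (e^{b_j} - 1))`. -/
lemma sum_exp_neg_finsupp_sum_le {b : ℕ → ℝ} (hb : ∀ j, 0 < b j)
    (hsum : Summable fun j => 1 / (Real.exp (b j) - 1)) (S : Finset (ℕ →₀ ℕ)) :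
    ∑ s ∈ S, Real.exp (-(s.sum fun j c => b j * c)) ≤
      Real.exp (∑' j, 1 / (Real.exp (b j) - 1)) := by
  obtain ⟨J, hJ⟩ : ∃ J, ∀ s ∈ S, s.support ⊆ range J := by
    obtain ⟨J, hJ⟩ := (S.biUnion Finsupp.support).exists_nat_subset_range
    exact ⟨J, fun s hs => (subset_biUnion_of_mem _ hs).trans hJ⟩
  obtain ⟨N, hN⟩ : ∃ N, ∀ s ∈ S, ∀ j < J, s j < N := by
    refine ⟨(S.sup fun s => (range J).sup s) + 1, fun s hs j hj => Nat.lt_succ_of_le ?_⟩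
    exact (le_sup (f := s) (mem_range.mpr hj)).trans
      (le_sup (f := fun s : ℕ →₀ ℕ => (range J).sup s) hs)
  have hexp : ∀ s ∈ S, Real.exp (-(s.sum fun j c => b j * c)) =
      ∏ j : Fin J, Real.exp (-b j) ^ s j := by
    intro s hs
    rw [Finsupp.sum_of_support_subset s (hJ s hs) _ (by simp), ← sum_neg_distrib, Real.exp_sum,
      ← Fin.prod_univ_eq_prod_range fun j => Real.exp (-(b j * s j))]
    refine prod_congr rfl fun j _ => ?_
    rw [← Real.exp_nat_mul]
    ring_nf
  have hinj : Set.InjOn (fun (s : ℕ →₀ ℕ) (j : Fin J) => s j) S := by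
    intro s hs t ht hst
    ext j
    by_cases hj : j < J
    · exact congrFun hst ⟨j, hj⟩
    · have hzero : ∀ u ∈ S, u j = 0 := fun u hu =>
        Finsupp.notMem_support_iff.mp fun h => hj (mem_range.mp (hJ u hu h))
      rw [hzero s hs, hzero t ht]
  have hfactor : ∀ j, ∑ c ∈ range N, Real.exp (-b j) ^ c ≤
      Real.exp (1 / (Real.exp (b j) - 1)) := by
    intro j
    have hlt : Real.exp (-b j) < 1 := Real.exp_lt_one_iff.mpr (neg_lt_zero.mpr (hb j))
    have hgt : 0 < Real.exp (b j) - 1 := sub_pos.mpr (Real.one_lt_exp_iff.mpr (hb j))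
    calc ∑ c ∈ range N, Real.exp (-b j) ^ c ≤ (1 - Real.exp (-b j))⁻¹ := by
          rw [← tsum_geometric_of_lt_one (Real.exp_pos _).le hlt]
          exact (summable_geometric_of_lt_one (Real.exp_pos _).le hlt).sum_le_tsum _
            fun c _ => by positivity
      _ = 1 / (Real.exp (b j) - 1) + 1 := by
          rw [Real.exp_neg, inv_eq_iff_eq_inv]
          field_simp
          ring
      _ ≤ _ := Real.add_one_le_exp _
  calc ∑ s ∈ S, Real.exp (-(s.sum fun j c => b j * c))
      = ∑ s ∈ S, ∏ j : Fin J, Real.exp (-b j) ^ s j := sum_congr rfl hexp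
    _ = ∑ p ∈ S.image fun (s : ℕ →₀ ℕ) (j : Fin J) => s j, ∏ j : Fin J, Real.exp (-b j) ^ p j := by
      rw [sum_image hinj]
    _ ≤ ∑ p ∈ Fintype.piFinset fun _ : Fin J => range N, ∏ j : Fin J, Real.exp (-b j) ^ p j := by
      refine sum_le_sum_of_subset_of_nonneg ?_ fun p _ _ => by positivity
      intro p hp
      obtain ⟨s, hs, rfl⟩ := mem_image.mp hp
      exact Fintype.mem_piFinset.mpr fun j => mem_range.mpr (hN s hs j j.isLt)
    _ = ∏ j : Fin J, ∑ c ∈ range N, Real.exp (-b j) ^ c :=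
      (prod_univ_sum (fun _ : Fin J => range N) fun j c => Real.exp (-b j) ^ c).symm
    _ ≤ ∏ j : Fin J, Real.exp (1 / (Real.exp (b j) - 1)) :=
      prod_le_prod (fun j _ => by positivity) fun j _ => hfactor j
    _ = Real.exp (∑ j ∈ range J, 1 / (Real.exp (b j) - 1)) := by
      rw [Real.exp_sum, ← Fin.prod_univ_eq_prod_range fun j => Real.exp (1 / (Real.exp (b j) - 1))]
    _ ≤ _ := by
      refine Real.exp_le_exp.mpr (hsum.sum_le_tsum _ fun j _ => ?_)
      exact one_div_nonneg.mpr (sub_nonneg.mpr (Real.one_le_exp (hb j).le))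

open Finset in
/-- Every finite subset of `E(T)` has at most `exp(M₀(m)) T^{m/a}` elements. -/
lemma card_le_of_subset_EsetZero {m : ℕ} (hm : 1 ≤ m) {a : ℝ} (ha : 0 < a)
    {r : ℕ → ℝ} (hrpos : ∀ j, 0 < r j)
    (hsum : Summable fun j : ℕ => 1 / (Real.exp ((m : ℝ) * r j / a) - 1))
    {T : ℝ} (hT : 0 ≤ T) (F : Finset ((Fin m → ℕ) × (ℕ →₀ ℕ)))
    (hF : (F : Set ((Fin m → ℕ) × (ℕ →₀ ℕ))) ⊆ EsetZero m a r T) :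
    (F.card : ℝ) ≤
      Real.exp (∑' j : ℕ, 1 / (Real.exp ((m : ℝ) * r j / a) - 1)) * T ^ ((m : ℝ) / a) := by
  classical
  have hm_pos : (0 : ℝ) < m := by exact_mod_cast hm
  have hfiber : ∀ s : ℕ →₀ ℕ, (#{p ∈ F | p.2 = s} : ℝ) ≤
      T ^ ((m : ℝ) / a) * Real.exp (-(s.sum fun j c => (m : ℝ) * r j / a * c)) := by
    intro s
    have hinj : Set.InjOn Prod.fst (SetLike.coe (F.filter fun p => p.2 = s)) := by
      intro p hp q hq hpq
      rw [mem_coe, mem_filter] at hp hq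
      exact Prod.ext hpq (hp.2.trans hq.2.symm)
    rw [← card_image_of_injOn hinj]
    have hU : 0 ≤ T * Real.exp (-(s.sum fun j c => r j * c)) := by positivity
    refine (card_le_rpow_of_forall_sup_rpow_le ha hU _ ?_).trans_eq ?_
    · intro k hk
      obtain ⟨p, hp, rfl⟩ := mem_image.mp hk
      rw [mem_filter] at hp
      have hmem := hF hp.1
      rw [EsetZero, Set.mem_ofPred_eq, hp.2] at hmem
      rwa [Real.exp_neg, ← div_eq_mul_inv, le_div_iff₀ (Real.exp_pos _)]
    · rw [Real.mul_rpow hT (Real.exp_pos _).le, ← Real.exp_mul]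
      congr 2
      simp only [Finsupp.sum, neg_mul, sum_mul]
      congr 1
      exact sum_congr rfl fun j _ => by ring
  calc (F.card : ℝ) = ∑ s ∈ F.image Prod.snd, (#{p ∈ F | p.2 = s} : ℝ) := by
        exact_mod_cast card_eq_sum_card_image Prod.snd F
    _ ≤ ∑ s ∈ F.image Prod.snd,
        T ^ ((m : ℝ) / a) * Real.exp (-(s.sum fun j c => (m : ℝ) * r j / a * c)) :=
      sum_le_sum fun s _ => hfiber s
    _ ≤ _ := by
      rw [← mul_sum, mul_comm]
      gcongr
      exact sum_exp_neg_finsupp_sum_le (fun j => div_pos (mul_pos hm_pos (hrpos j)) ha) hsum _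

/-- **Theorem (upper bound, Sobolev-analytic hyperbolic cross, `p = 0`).**
If `M₀(m) = ∑_{j=1}^∞ 1/(e^{m r_j/a} - 1) < ∞`, then for every `T ≥ 1` the set `E(T)`
is finite and `|E(T)| ≤ (3/2)^{2m} exp(M₀(m)) T^{m/a}`. -/
theorem card_EsetZero_le (m : ℕ) (hm : 1 ≤ m) (a : ℝ) (ha : 0 < a)
    (r : ℕ → ℝ) (hrpos : ∀ j, 0 < r j)
    (hsum : Summable fun j : ℕ => 1 / (Real.exp ((m : ℝ) * r j / a) - 1))
    (T : ℝ) (hT : 1 ≤ T) :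
    (EsetZero m a r T).Finite ∧
    (Nat.card (EsetZero m a r T) : ℝ) ≤
      (3/2 : ℝ) ^ (2 * m) *
        Real.exp (∑' j : ℕ, 1 / (Real.exp ((m : ℝ) * r j / a) - 1)) *
        T ^ ((m : ℝ) / a) := by
  have hbound := card_le_of_subset_EsetZero hm ha hrpos hsum (zero_le_one.trans hT)
  have hfin : (EsetZero m a r T).Finite := by
    by_contra hinf
    obtain ⟨n, hn⟩ := exists_nat_gt
      (Real.exp (∑' j : ℕ, 1 / (Real.exp ((m : ℝ) * r j / a) - 1)) * T ^ ((m : ℝ) / a))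
    obtain ⟨F, hF, hcard⟩ := Set.Infinite.exists_subset_card_eq hinf n
    exact (hbound F hF).not_gt (hcard ▸ hn)
  refine ⟨hfin, ?_⟩
  rw [Nat.card_coe_set_eq, Set.ncard_eq_toFinset_card _ hfin, mul_assoc]
  refine (hbound hfin.toFinset hfin.coe_toFinset.subset).trans ?_
  exact le_mul_of_one_le_left (by positivity) (one_le_pow₀ (by norm_num))
end

section
/- Let η > 0 and p, q > 0 satisfy η ≥ (q + √q)/p and η > pq. Then ∑_{k=1}^{∞} e^{−η k} (1 + pk)^{q} ≤ ((1 + p/2)^{q} / (η − pq)) · e^{−η/2}. -/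
open Real in
/-- The midpoint sum of `exp (-d * x)` over `[0, ∞)` is at most its integral `1 / d`. -/
theorem exp_neg_half_mul_inv_one_sub_exp_neg_le {d : ℝ} (hd : 0 < d) :
    exp (-d / 2) * (1 - exp (-d))⁻¹ ≤ 1 / d := by
  have hlt : exp (-d) < 1 := exp_lt_one_iff.mpr (by linarith)
  have hsinh : d / 2 ≤ sinh (d / 2) := self_le_sinh_iff.mpr (by linarith)
  rw [sinh_eq] at hsinh
  have hle : d * exp (-d / 2) ≤ 1 - exp (-d) := by
    have hmul := mul_le_mul_of_nonneg_right hsinh (exp_pos (-d / 2)).le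
    have e1 : exp (d / 2) * exp (-d / 2) = 1 := by
      rw [← exp_add, ← exp_zero]; congr 1; ring
    have e2 : exp (-(d / 2)) * exp (-d / 2) = exp (-d) := by
      rw [← exp_add]; congr 1; ring
    nlinarith
  rw [← div_eq_mul_inv, div_le_div_iff₀ (by linarith) hd]
  linarith

open Real in
theorem one_add_mul_rpow_le {p q x y : ℝ} (hp : 0 ≤ p) (hq : 0 ≤ q) (hx : 0 ≤ x) (hxy : x ≤ y) :
    (1 + p * y) ^ q ≤ (1 + p * x) ^ q * exp (p * q * (y - x)) := by
  have hx' : 0 ≤ p * x := mul_nonneg hp hx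
  have hyx : 0 ≤ p * (y - x) := mul_nonneg hp (by linarith)
  have hexp := add_one_le_exp (p * (y - x))
  have hbase : 1 + p * y ≤ (1 + p * x) * exp (p * (y - x)) := by nlinarith
  calc (1 + p * y) ^ q ≤ ((1 + p * x) * exp (p * (y - x))) ^ q :=
        rpow_le_rpow (by nlinarith) hbase hq
    _ = (1 + p * x) ^ q * exp (p * q * (y - x)) := by
        rw [mul_rpow (by linarith) (exp_pos _).le, ← exp_mul]
        congr 2; ring

/-- **Lemma.** For `η > 0` and `p, q > 0` with `η ≥ (q + √q)/p` and `η > pq`,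
`∑_{k=1}^∞ e^{-ηk}(1+pk)^q ≤ ((1+p/2)^q/(η-pq)) e^{-η/2}`. -/
theorem tsum_exp_mul_rpow_le (η p q : ℝ) (hη : 0 < η) (hp : 0 < p) (hq : 0 < q)
    (h1 : (q + Real.sqrt q) / p ≤ η) (h2 : p * q < η) :
    ∑' k : ℕ, Real.exp (-η * ((k : ℝ) + 1)) * (1 + p * ((k : ℝ) + 1)) ^ q ≤
      (1 + p / 2) ^ q / (η - p * q) * Real.exp (-η / 2) := by
  set d := η - p * q with hd_def
  have hd : 0 < d := sub_pos.mpr h2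
  set A := (1 + p / 2) ^ q * Real.exp (-η / 2) with hA
  have hA0 : 0 ≤ A := by positivity
  have hterm (k : ℕ) : Real.exp (-η * ((k : ℝ) + 1)) * (1 + p * ((k : ℝ) + 1)) ^ q ≤
      A * Real.exp (-d / 2) * Real.exp (-d) ^ k := by
    have hk : (0 : ℝ) ≤ k := k.cast_nonneg
    have hpow := one_add_mul_rpow_le (x := 1 / 2) (y := (k : ℝ) + 1) hp.le hq.le
      (by norm_num) (by linarith)
    calc _ ≤ Real.exp (-η * ((k : ℝ) + 1)) *
          ((1 + p * (1 / 2)) ^ q * Real.exp (p * q * ((k : ℝ) + 1 - 1 / 2))) := by gcongr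
      _ = (1 + p / 2) ^ q *
          Real.exp (-η * ((k : ℝ) + 1) + p * q * ((k : ℝ) + 1 - 1 / 2)) := by
        rw [Real.exp_add, mul_one_div]; ring
      _ = (1 + p / 2) ^ q * Real.exp (-η / 2 + -d / 2 + k * -d) := by
        rw [hd_def]; congr 2; ring
      _ = _ := by rw [Real.exp_add, Real.exp_add, Real.exp_nat_mul, hA]; ring
  have hgeom := (hasSum_geometric_of_lt_one (Real.exp_pos (-d)).le
    (Real.exp_lt_one_iff.mpr (by linarith))).mul_left (A * Real.exp (-d / 2))
  have hsummable := Summable.of_nonneg_of_le (fun k : ℕ => by positivity) hterm hgeom.summable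
  calc _ ≤ A * Real.exp (-d / 2) * (1 - Real.exp (-d))⁻¹ :=
        hasSum_le hterm hsummable.hasSum hgeom
    _ ≤ A * (1 / d) := by
        rw [mul_assoc]
        exact mul_le_mul_of_nonneg_left (exp_neg_half_mul_inv_one_sub_exp_neg_le hd) hA0
    _ = _ := by rw [hA]; ring
end

section
/- Let m ∈ ℕ with m ≥ 1, a > 0, p, q > 0, and let r = (r_j)_{j≥1} be positive reals satisfying r_j ≥ (q + √(q a/m))/p and r_j > pq for all j, and M_{p,q}(m) := (1 + p/2)^{q m/a} · ∑_{j=1}^{∞} e^{−m r_j/(2a)} / (m r_j/a − p q m/a) < ∞. Then for every real T ≥ 1 the set E(T) := { (k,s) ∈ ℤ_+^m × ℤ_+^∞, s finitely supported : max_{1≤j≤m}(1+k_j)^a · ∏_{j=1}^{∞}(1 + p s_j)^{−q} · exp(∑_{j=1}^{∞} r_j s_j) ≤ T } is finite and |E(T)| ≤ (3/2)^{2m} · exp(M_{p,q}(m)) · T^{m/a}. -/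
/-- The analytic-type hyperbolic cross with polynomial prefactor:
`E(T) = { (k,s) : max_{1≤j≤m}(1+k_j)^a · ∏_j (1+p s_j)^{-q} · exp(∑_j r_j s_j) ≤ T }`,
where `k ∈ ℤ_+^m` and `s ∈ ℤ_+^∞` is finitely supported. -/
noncomputable def EsetPQ (m : ℕ) (a p q : ℝ) (r : ℕ → ℝ) (T : ℝ) :
    Set ((Fin m → ℕ) × (ℕ →₀ ℕ)) :=
  {x | ((Finset.univ.sup (fun j => 1 + x.1 j) : ℕ) : ℝ) ^ a *
        (x.2.prod fun j c => (1 + p * (c : ℝ)) ^ (-q)) *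
        Real.exp (x.2.sum fun j c => r j * c) ≤ T}

open Finset in
/-- A finite sum of product weights over finitely supported sequences is bounded by the
exponential of the sum of the weights of the nonzero single entries. -/
theorem sum_finsupp_prod_le_exp (h : ℕ → ℕ → ℝ) (b : ℕ → ℝ) (h_nonneg : ∀ j n, 0 ≤ h j n)
    (h_zero : ∀ j, h j 0 = 1) (b_nonneg : ∀ j, 0 ≤ b j) (hb : Summable b)
    (h_le : ∀ j N, ∑ n ∈ range N, h j (n + 1) ≤ b j) (S : Finset (ℕ →₀ ℕ)) :
    ∑ s ∈ S, s.prod h ≤ Real.exp (∑' j, b j) := by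
  classical
  set J := S.biUnion fun s => s.support
  set N := S.sup fun s => s.sum fun _ c => c
  have supp_sub : ∀ s ∈ S, s.support ⊆ J := fun s hs =>
    subset_biUnion_of_mem (fun s => s.support) hs
  have val_le : ∀ s ∈ S, ∀ j, s j ≤ N := by
    intro s hs j
    refine le_trans ?_ (le_sup (f := fun s : ℕ →₀ ℕ => s.sum fun _ c => c) hs)
    by_cases hj : j ∈ s.support
    · exact single_le_sum (f := fun i => s i) (fun _ _ => Nat.zero_le _) hj
    · simp [Finsupp.notMem_support_iff.mp hj]
  have inj : Set.InjOn (fun (s : ℕ →₀ ℕ) (j : ℕ) (_ : j ∈ J) => s j) S := by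
    intro s hs t ht hst
    ext j
    by_cases hj : j ∈ J
    · exact congrFun (congrFun hst j) hj
    · rw [Finsupp.notMem_support_iff.mp fun h' => hj (supp_sub s hs h'),
        Finsupp.notMem_support_iff.mp fun h' => hj (supp_sub t ht h')]
  calc ∑ s ∈ S, s.prod h
      = ∑ s ∈ S, ∏ x ∈ J.attach, h x (s x) := by
        refine sum_congr rfl fun s hs => ?_
        rw [Finsupp.prod_of_support_subset s (supp_sub s hs) h fun j _ => h_zero j]
        exact (prod_attach J fun x => h x (s x)).symm
    _ = ∑ f ∈ S.image (fun (s : ℕ →₀ ℕ) (j : ℕ) (_ : j ∈ J) => s j),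
          ∏ x ∈ J.attach, h x (f x x.2) := by rw [sum_image inj]
    _ ≤ ∑ f ∈ J.pi fun _ => range (N + 1), ∏ x ∈ J.attach, h x (f x x.2) := by
        refine sum_le_sum_of_subset_of_nonneg ?_ fun f _ _ => prod_nonneg fun x _ => h_nonneg _ _
        intro f hf
        obtain ⟨s, hs, rfl⟩ := mem_image.mp hf
        exact mem_pi.mpr fun j _ => mem_range.mpr (Nat.lt_succ_of_le (val_le s hs j))
    _ = ∏ j ∈ J, ∑ n ∈ range (N + 1), h j n := (prod_sum J (fun _ => range (N + 1)) h).symm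
    _ ≤ ∏ j ∈ J, Real.exp (b j) := by
        refine prod_le_prod (fun j _ => sum_nonneg fun n _ => h_nonneg j n) fun j _ => ?_
        rw [sum_range_succ', h_zero]
        exact (add_le_add_left (h_le j N) 1).trans (Real.add_one_le_exp _)
    _ = Real.exp (∑ j ∈ J, b j) := (Real.exp_sum J b).symm
    _ ≤ Real.exp (∑' j, b j) :=
        Real.exp_le_exp.mpr (hb.sum_le_tsum J fun j _ => b_nonneg j)

/-- The midpoint rule underestimates the integral of `exp (-c x)` over `[0, ∞)`. -/
theorem sum_exp_neg_midpoint_le {c : ℝ} (hc : 0 < c) (N : ℕ) :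
    ∑ n ∈ Finset.range N, Real.exp (-c * (n + 1 / 2)) ≤ 1 / c := by
  have key : ∀ x : ℝ, c * Real.exp (-c * (x + 1 / 2)) ≤
      Real.exp (-c * x) - Real.exp (-c * (x + 1)) := by
    intro x
    have sinh_ge := Real.self_le_sinh_iff.mpr (half_pos hc).le
    rw [Real.sinh_eq] at sinh_ge
    have left_end : Real.exp (-c * x) = Real.exp (-c * (x + 1 / 2)) * Real.exp (c / 2) := by
      rw [← Real.exp_add]; ring_nf
    have right_end :
        Real.exp (-c * (x + 1)) = Real.exp (-c * (x + 1 / 2)) * Real.exp (-(c / 2)) := by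
      rw [← Real.exp_add]; ring_nf
    rw [left_end, right_end]
    nlinarith [Real.exp_pos (-c * (x + 1 / 2))]
  have telescope : c * ∑ n ∈ Finset.range N, Real.exp (-c * (n + 1 / 2)) ≤
      1 - Real.exp (-c * N) := by
    induction N with
    | zero => simp
    | succ N ih =>
      rw [Finset.sum_range_succ, mul_add]
      have step := key N
      push_cast
      linarith
  rw [le_div_iff₀ hc]
  linarith [Real.exp_pos (-c * N)]

/-- An incomplete-Gamma-type bound for `∑_{n ≥ 1} (1 + p n)^Q e^{-R n}`. -/
theorem sum_rpow_mul_exp_neg_le {p Q R : ℝ} (hp : 0 < p) (hQ : 0 ≤ Q) (hR : p * Q < R) (N : ℕ) :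
    ∑ n ∈ Finset.range N, (1 + p * ((n + 1 : ℕ) : ℝ)) ^ Q * Real.exp (-R * ((n + 1 : ℕ) : ℝ)) ≤
      (1 + p / 2) ^ Q * (Real.exp (-R / 2) / (R - p * Q)) := by
  have term_le : ∀ n : ℕ,
      (1 + p * ((n + 1 : ℕ) : ℝ)) ^ Q * Real.exp (-R * ((n + 1 : ℕ) : ℝ)) ≤
        (1 + p / 2) ^ Q * Real.exp (-R / 2) * Real.exp (-(R - p * Q) * (n + 1 / 2)) := by
    intro n
    have base_le : 1 + p * ((n + 1 : ℕ) : ℝ) ≤ (1 + p / 2) * Real.exp (p * (n + 1 / 2)) := by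
      have exp_ge := Real.add_one_le_exp (p * ((n : ℝ) + 1 / 2))
      have mul_ge := mul_le_mul_of_nonneg_left exp_ge (by positivity : 0 ≤ 1 + p / 2)
      refine le_trans ?_ mul_ge
      have extra : 0 ≤ p / 2 * (p * ((n : ℝ) + 1 / 2)) := by positivity
      push_cast
      linarith
    calc (1 + p * ((n + 1 : ℕ) : ℝ)) ^ Q * Real.exp (-R * ((n + 1 : ℕ) : ℝ))
        ≤ ((1 + p / 2) * Real.exp (p * (n + 1 / 2))) ^ Q *
            Real.exp (-R * ((n + 1 : ℕ) : ℝ)) := by gcongr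
      _ = (1 + p / 2) ^ Q * Real.exp (-R / 2) * Real.exp (-(R - p * Q) * (n + 1 / 2)) := by
        rw [Real.mul_rpow (by positivity) (Real.exp_pos _).le, ← Real.exp_mul,
          mul_assoc, mul_assoc ((1 + p / 2) ^ Q), ← Real.exp_add, ← Real.exp_add]
        push_cast
        ring_nf
  calc _ ≤ ∑ n ∈ Finset.range N,
        (1 + p / 2) ^ Q * Real.exp (-R / 2) * Real.exp (-(R - p * Q) * (n + 1 / 2)) :=
        Finset.sum_le_sum fun n _ => term_le n
    _ = (1 + p / 2) ^ Q * Real.exp (-R / 2) *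
          ∑ n ∈ Finset.range N, Real.exp (-(R - p * Q) * (n + 1 / 2)) :=
        (Finset.mul_sum ..).symm
    _ ≤ (1 + p / 2) ^ Q * Real.exp (-R / 2) * (1 / (R - p * Q)) := by
        gcongr
        exact sum_exp_neg_midpoint_le (sub_pos.mpr hR) N
    _ = _ := by ring

/-- The number of points of `F` above `s` is at most the volume of the corresponding cube. -/
theorem card_fiber_EsetPQ_le {m : ℕ} {a p q : ℝ} (ha : 0 < a) (hp : 0 < p)
    (r : ℕ → ℝ) {T : ℝ} (hT : 1 ≤ T) (F : Finset ((Fin m → ℕ) × (ℕ →₀ ℕ)))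
    (hF : ↑F ⊆ EsetPQ m a p q r T) (s : ℕ →₀ ℕ) :
    ((F.filter fun x => x.2 = s).card : ℝ) ≤ T ^ ((m : ℝ) / a) *
      s.prod fun j c => (1 + p * (c : ℝ)) ^ (q * m / a) * Real.exp (-(m * r j / a) * (c : ℝ)) := by
  set W : ℝ := s.prod fun j c => (1 + p * (c : ℝ)) ^ q * Real.exp (-(r j * c)) with hW
  have base_pos : ∀ c : ℕ, 0 < 1 + p * (c : ℝ) := fun c => by positivity
  have W_pos : 0 < W :=
    Finset.prod_pos fun j _ => mul_pos (Real.rpow_pos_of_pos (base_pos _) _) (Real.exp_pos _)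
  have W_cancel : ((s.prod fun j c => (1 + p * (c : ℝ)) ^ (-q)) *
      Real.exp (s.sum fun j c => r j * c)) * W = 1 := by
    rw [hW, Finsupp.sum, Real.exp_sum, Finsupp.prod, Finsupp.prod, ← Finset.prod_mul_distrib,
      ← Finset.prod_mul_distrib]
    refine Finset.prod_eq_one fun j _ => ?_
    rw [Real.rpow_neg (base_pos _).le, Real.exp_neg]
    have := Real.rpow_pos_of_pos (base_pos (s j)) q
    field_simp
  have W_rpow : W ^ ((m : ℝ) / a) =
      s.prod fun j c => (1 + p * (c : ℝ)) ^ (q * m / a) *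
        Real.exp (-(m * r j / a) * (c : ℝ)) := by
    rw [hW, Finsupp.prod, Finsupp.prod, ← Real.finsetProd_rpow _ _ fun j _ =>
      (mul_pos (Real.rpow_pos_of_pos (base_pos _) _) (Real.exp_pos _)).le]
    refine Finset.prod_congr rfl fun j _ => ?_
    rw [Real.mul_rpow (Real.rpow_pos_of_pos (base_pos _) _).le (Real.exp_pos _).le,
      ← Real.rpow_mul (base_pos _).le, ← Real.exp_mul]
    ring_nf
  have TW_pos : 0 < T * W := mul_pos (by linarith) W_pos
  set L := ⌊(T * W) ^ (1 / a)⌋₊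
  have fst_mem : ∀ x ∈ F.filter (fun x => x.2 = s),
      x.1 ∈ Fintype.piFinset fun _ : Fin m => Finset.range L := by
    intro x hx
    obtain ⟨hxF, rfl⟩ := Finset.mem_filter.mp hx
    have hxE : _ ≤ T := hF hxF
    set V : ℕ := Finset.univ.sup fun j => 1 + x.1 j
    have V_rpow_le : (V : ℝ) ^ a ≤ T * W := by
      have scaled := mul_le_mul_of_nonneg_right hxE W_pos.le
      rwa [mul_assoc (_ ^ a), mul_assoc (_ ^ a), W_cancel, mul_one] at scaled
    have V_le : V ≤ L := by
      refine Nat.le_floor ?_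
      rw [one_div]
      exact (Real.le_rpow_inv_iff_of_pos (Nat.cast_nonneg _) TW_pos.le ha).mpr V_rpow_le
    refine Fintype.mem_piFinset.mpr fun j => Finset.mem_range.mpr ?_
    have := Finset.le_sup (f := fun j => 1 + x.1 j) (Finset.mem_univ j)
    change 1 + x.1 j ≤ V at this
    omega
  have card_le : (F.filter fun x => x.2 = s).card ≤ L ^ m := by
    have := Finset.card_le_card_of_injOn Prod.fst fst_mem (by
      intro x hx y hy hxy
      exact Prod.ext hxy
        ((Finset.mem_filter.mp hx).2.trans (Finset.mem_filter.mp hy).2.symm))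
    simpa using this
  calc ((F.filter fun x => x.2 = s).card : ℝ) ≤ (L : ℝ) ^ m := by exact_mod_cast card_le
    _ ≤ ((T * W) ^ (1 / a)) ^ m := by
        gcongr
        exact Nat.floor_le (Real.rpow_nonneg TW_pos.le _)
    _ = T ^ ((m : ℝ) / a) * W ^ ((m : ℝ) / a) := by
        rw [← Real.rpow_natCast, ← Real.rpow_mul TW_pos.le, Real.mul_rpow (by linarith) W_pos.le]
        ring_nf
    _ = _ := by rw [W_rpow]

/-- **Theorem (upper bound, Sobolev-analytic hyperbolic cross, `p > 0`).**
If `r_j ≥ (q + √(qa/m))/p`, `r_j > pq` for all `j`, and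
`M_{p,q}(m) = (1+p/2)^{qm/a} ∑_j e^{-m r_j/(2a)}/(m r_j/a - pqm/a) < ∞`, then for
every `T ≥ 1` the set `E(T)` is finite and
`|E(T)| ≤ (3/2)^{2m} exp(M_{p,q}(m)) T^{m/a}`. -/
theorem card_EsetPQ_le (m : ℕ) (hm : 1 ≤ m) (a p q : ℝ) (ha : 0 < a)
    (hp : 0 < p) (hq : 0 < q) (r : ℕ → ℝ) (hrpos : ∀ j, 0 < r j)
    (hr1 : ∀ j, (q + Real.sqrt (q * a / m)) / p ≤ r j)
    (hr2 : ∀ j, p * q < r j)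
    (hsum : Summable fun j : ℕ =>
      Real.exp (-((m : ℝ) * r j) / (2 * a)) / ((m : ℝ) * r j / a - p * q * m / a))
    (T : ℝ) (hT : 1 ≤ T) :
    (EsetPQ m a p q r T).Finite ∧
    (Nat.card (EsetPQ m a p q r T) : ℝ) ≤
      (3/2 : ℝ) ^ (2 * m) *
        Real.exp ((1 + p / 2) ^ (q * m / a) *
          ∑' j : ℕ,
            Real.exp (-((m : ℝ) * r j) / (2 * a)) / ((m : ℝ) * r j / a - p * q * m / a)) *
        T ^ ((m : ℝ) / a) := by
  set b : ℕ → ℝ := fun j =>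
    Real.exp (-((m : ℝ) * r j) / (2 * a)) / ((m : ℝ) * r j / a - p * q * m / a) with hb
  have m_pos : (0 : ℝ) < m := by exact_mod_cast hm
  have rate_lt : ∀ j, p * (q * m / a) < m * r j / a := by
    intro j
    rw [← mul_div_assoc, div_lt_div_iff_of_pos_right ha]
    nlinarith [hr2 j]
  have b_nonneg : ∀ j, 0 ≤ b j := fun j =>
    div_nonneg (Real.exp_pos _).le (sub_nonneg.mpr (by convert (rate_lt j).le using 1; ring))
  have const_pos : 0 < (1 + p / 2) ^ (q * m / a) := by positivity
  have weight_sum_le := sum_finsupp_prod_le_exp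
    (fun j c => (1 + p * (c : ℝ)) ^ (q * m / a) * Real.exp (-(m * r j / a) * (c : ℝ)))
    (fun j => (1 + p / 2) ^ (q * m / a) * b j) (fun j n => by positivity) (fun j => by simp)
    (fun j => mul_nonneg const_pos.le (b_nonneg j)) (hsum.mul_left _)
    (fun j N => by
      refine (sum_rpow_mul_exp_neg_le hp (by positivity) (rate_lt j) N).trans_eq ?_
      simp only [hb]
      congr 3 <;> ring)
  rw [tsum_mul_left] at weight_sum_le
  set B : ℝ := Real.exp ((1 + p / 2) ^ (q * m / a) * ∑' j, b j)
  have T_pow_pos : 0 < T ^ ((m : ℝ) / a) := Real.rpow_pos_of_pos (by linarith) _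
  have finset_card_le : ∀ F : Finset ((Fin m → ℕ) × (ℕ →₀ ℕ)),
      ↑F ⊆ EsetPQ m a p q r T → (F.card : ℝ) ≤ B * T ^ ((m : ℝ) / a) := by
    classical
    intro F hF
    rw [Finset.card_eq_sum_card_image Prod.snd F]
    push_cast
    refine (Finset.sum_le_sum fun s _ => card_fiber_EsetPQ_le ha hp r hT F hF s).trans ?_
    rw [← Finset.mul_sum, mul_comm]
    exact mul_le_mul_of_nonneg_right (weight_sum_le _) T_pow_pos.le
  have finite : (EsetPQ m a p q r T).Finite := by
    by_contra infinite
    obtain ⟨F, hF, card_eq⟩ := Set.Infinite.exists_subset_card_eq infinite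
      (⌊B * T ^ ((m : ℝ) / a)⌋₊ + 1)
    have card_le := finset_card_le F hF
    rw [card_eq] at card_le
    push_cast at card_le
    linarith [Nat.lt_floor_add_one (B * T ^ ((m : ℝ) / a))]
  refine ⟨finite, ?_⟩
  rw [Nat.card_coe_set_eq, Set.ncard_eq_toFinset_card _ finite]
  refine (finset_card_le finite.toFinset (by simp)).trans ?_
  rw [mul_assoc]
  exact le_mul_of_one_le_left (by positivity) (one_le_pow₀ (by norm_num))
end

section
/- Let d ∈ ℕ with d ≥ 1, let r_1, …, r_d > 0, and let T be a real number with T ≥ exp(r_j) for all j = 1,…,d. Then the set E_d(T) := { s ∈ ℤ_+^d : ∑_{j=1}^{d} r_j s_j ≤ log T } satisfies (∏_{j=1}^{d} 1/r_j) · (log T)^d / d! ≤ |E_d(T)| ≤ (∏_{j=1}^{d} 1/r_j) · (log T + ∑_{j=1}^{d} r_j)^d / d!. -/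
/-- The weighted discrete simplex
`E_d(T) = { s ∈ ℤ_+^d : ∑_{j=1}^d r_j s_j ≤ log T }`. -/
def EdSet (d : ℕ) (r : Fin d → ℝ) (T : ℝ) : Set (Fin d → ℕ) :=
  {s | ∑ j, r j * (s j : ℝ) ≤ Real.log T}

lemma pow_succ_add_le_add_pow (n : ℕ) {y h : ℝ} (hy : 0 ≤ y) (hh : 0 ≤ h) :
    y ^ (n + 1) + (n + 1) * h * y ^ n ≤ (y + h) ^ (n + 1) := by
  induction n with
  | zero => simp
  | succ n ih =>
    have h1 := mul_le_mul_of_nonneg_right ih (add_nonneg hy hh)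
    have h2 : 0 ≤ (n + 1) * h * y ^ n * h := by positivity
    rw [← pow_succ] at h1
    push_cast
    calc _ ≤ (y ^ (n + 1) + (n + 1) * h * y ^ n) * (y + h) := by
          linear_combination h2
      _ ≤ _ := h1

lemma add_pow_le_pow_succ_add (n : ℕ) {y h : ℝ} (hy : 0 ≤ y) (hh : 0 ≤ h) :
    (y + h) ^ (n + 1) ≤ y ^ (n + 1) + (n + 1) * h * (y + h) ^ n := by
  induction n with
  | zero => simp
  | succ n ih =>
    have h1 := mul_le_mul_of_nonneg_right ih (add_nonneg hy hh)
    have h2 : h * y ^ (n + 1) ≤ h * (y + h) ^ (n + 1) := by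
      gcongr
      linarith
    rw [← pow_succ] at h1
    push_cast
    linear_combination h1 + h2

/-- The lattice points of the weighted simplex of size `L`. -/
def simplexPoints (d : ℕ) (r : Fin d → ℝ) (L : ℝ) : Set (Fin d → ℕ) :=
  {s | ∑ j, r j * (s j : ℝ) ≤ L}

lemma simplexPoints_eq_empty {d : ℕ} {r : Fin d → ℝ} (hr : ∀ j, 0 < r j) {L : ℝ} (hL : L < 0) :
    simplexPoints d r L = ∅ := by
  refine Set.eq_empty_of_forall_notMem fun s hs => ?_
  have h : 0 ≤ ∑ j, r j * (s j : ℝ) :=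
    Finset.sum_nonneg fun j _ => mul_nonneg (hr j).le (Nat.cast_nonneg _)
  exact absurd (h.trans hs) (not_le.mpr hL)

/-- Points with first coordinate zero, together with points with positive first coordinate. -/
lemma simplexPoints_succ (d : ℕ) (r : Fin (d + 1) → ℝ) (L : ℝ) :
    simplexPoints (d + 1) r L =
      Fin.cons (α := fun _ => ℕ) 0 '' simplexPoints d (Fin.tail r) L ∪
      (fun s : Fin (d + 1) → ℕ => s + Pi.single 0 1) '' simplexPoints (d + 1) r (L - r 0) := by
  ext s
  simp only [simplexPoints, Set.mem_union, Set.mem_image, Set.mem_ofPred_eq, Fin.sum_univ_succ]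
  constructor
  · intro hs
    rcases Nat.eq_zero_or_pos (s 0) with h0 | h0
    · refine Or.inl ⟨Fin.tail s, ?_, ?_⟩
      · simpa [h0, Fin.tail] using hs
      · rw [← h0, Fin.cons_self_tail]
    · obtain ⟨k, hk⟩ := Nat.exists_eq_succ_of_ne_zero h0.ne'
      refine Or.inr ⟨Fin.cons k (Fin.tail s), ?_, ?_⟩
      · simp only [hk, Nat.cast_succ] at hs
        simp only [Fin.cons_zero, Fin.cons_succ, Fin.tail]
        linarith
      · ext j
        refine Fin.cases ?_ (fun i => ?_) j <;> simp [hk, Fin.tail]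
  · rintro (⟨t, ht, rfl⟩ | ⟨t, ht, rfl⟩)
    · simpa [Fin.tail] using ht
    · simp only [Pi.add_apply, Pi.single_eq_same, Nat.cast_add, Nat.cast_one, ne_eq,
        Fin.succ_ne_zero, not_false_eq_true, Pi.single_eq_of_ne, add_zero]
      linarith

lemma ncard_simplexPoints_succ {d : ℕ} {r : Fin (d + 1) → ℝ} {L : ℝ}
    (h₁ : (simplexPoints d (Fin.tail r) L).Finite)
    (h₂ : (simplexPoints (d + 1) r (L - r 0)).Finite) :
    (simplexPoints (d + 1) r L).ncard =
      (simplexPoints d (Fin.tail r) L).ncard + (simplexPoints (d + 1) r (L - r 0)).ncard := by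
  rw [simplexPoints_succ, Set.ncard_union_eq _ (h₁.image _) (h₂.image _),
    Set.ncard_image_of_injective _ (Fin.cons_right_injective _),
    Set.ncard_image_of_injective _ (add_left_injective _)]
  rw [Set.disjoint_left]
  rintro _ ⟨s, -, rfl⟩ ⟨t, -, h⟩
  simpa using congrFun h 0

lemma ncard_simplexPoints_bounds (d : ℕ) (r : Fin d → ℝ) (hr : ∀ j, 0 < r j) (L : ℝ)
    (hL : 0 ≤ L) :
    (simplexPoints d r L).Finite ∧
    L ^ d ≤ (simplexPoints d r L).ncard * (d.factorial * ∏ j, r j) ∧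
    (simplexPoints d r L).ncard * (d.factorial * ∏ j, r j) ≤ (L + ∑ j, r j) ^ d := by
  induction d generalizing L with
  | zero =>
    have h : simplexPoints 0 r L = Set.univ := by
      ext s
      simpa [simplexPoints] using hL
    simp [h, Set.finite_univ, Set.ncard_univ]
  | succ d ih =>
    have hr0 := hr 0
    have hR : 0 ≤ ∑ j, Fin.tail r j := Finset.sum_nonneg fun j _ => (hr j.succ).le
    obtain ⟨n, hn⟩ := exists_nat_gt (L / r 0)
    rw [div_lt_iff₀ hr0] at hn
    induction n generalizing L with
    | zero => simp at hn; linarith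
    | succ n ihn =>
      obtain ⟨hf, hlow, hup⟩ := ih (Fin.tail r) (fun j => hr j.succ) L hL
      have hprod : ∏ j, r j = r 0 * ∏ j, Fin.tail r j := Fin.prod_univ_succ r
      have hsum : ∑ j, r j = r 0 + ∑ j, Fin.tail r j := Fin.sum_univ_succ r
      have hc : (0 : ℝ) ≤ (d + 1) * r 0 := by positivity
      have hlow' := mul_le_mul_of_nonneg_left hlow hc
      have hup' := mul_le_mul_of_nonneg_left hup hc
      have hpow := pow_succ_add_le_add_pow d (add_nonneg hL hR) hr0.le
      rcases lt_or_ge L (r 0) with hlt | hge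
      · have he : simplexPoints (d + 1) r (L - r 0) = ∅ := simplexPoints_eq_empty hr (by linarith)
        refine ⟨?_, ?_⟩
        · rw [simplexPoints_succ, he]
          simpa using hf.image _
        rw [ncard_simplexPoints_succ hf (by simp [he]), he, hprod, hsum, Nat.factorial_succ]
        push_cast [Set.ncard_empty]
        have h1 : L ^ (d + 1) ≤ (d + 1) * r 0 * L ^ d := by
          rw [pow_succ']
          gcongr
          nlinarith [(Nat.cast_nonneg d : (0 : ℝ) ≤ d)]
        have h2 : 0 ≤ (L + ∑ j, Fin.tail r j) ^ (d + 1) := by positivity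
        refine ⟨by linear_combination h1 + hlow', ?_⟩
        rw [show L + (r 0 + ∑ j, Fin.tail r j) = L + ∑ j, Fin.tail r j + r 0 by ring]
        linear_combination hup' + h2 + hpow
      · have hsub : 0 ≤ L - r 0 := by linarith
        obtain ⟨gf, glow, gup⟩ := ihn (L - r 0) hsub (by push_cast at hn; linarith)
        refine ⟨?_, ?_⟩
        · rw [simplexPoints_succ]
          exact (hf.image _).union (gf.image _)
        have h1 := add_pow_le_pow_succ_add d hsub hr0.le
        rw [sub_add_cancel] at h1
        rw [hprod, Nat.factorial_succ] at glow gup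
        rw [hsum, show L - r 0 + (r 0 + ∑ j, Fin.tail r j) = L + ∑ j, Fin.tail r j by ring] at gup
        rw [ncard_simplexPoints_succ hf gf, hprod, hsum, Nat.factorial_succ,
          show L + (r 0 + ∑ j, Fin.tail r j) = L + ∑ j, Fin.tail r j + r 0 by ring]
        push_cast at glow gup ⊢
        exact ⟨by linear_combination h1 + hlow' + glow, by linear_combination hup' + gup + hpow⟩

/-- **Lemma.** For `d ≥ 1`, `r_j > 0` and `T ≥ exp(r_j)` for all `j`, the set `E_d(T)`
is finite and `(∏_j 1/r_j)(log T)^d/d! ≤ |E_d(T)| ≤ (∏_j 1/r_j)(log T + ∑_j r_j)^d/d!`. -/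
theorem card_EdSet_bounds (d : ℕ) (hd : 1 ≤ d) (r : Fin d → ℝ) (hr : ∀ j, 0 < r j)
    (T : ℝ) (hT : ∀ j, Real.exp (r j) ≤ T) :
    (EdSet d r T).Finite ∧
    (∏ j, 1 / r j) * (Real.log T) ^ d / d.factorial ≤ (Nat.card (EdSet d r T) : ℝ) ∧
    (Nat.card (EdSet d r T) : ℝ) ≤
      (∏ j, 1 / r j) * (Real.log T + ∑ j, r j) ^ d / d.factorial := by
  have hL : 0 ≤ Real.log T := by
    have h0 := hr ⟨0, hd⟩
    exact Real.log_nonneg ((Real.one_le_exp h0.le).trans (hT ⟨0, hd⟩))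
  obtain ⟨hf, hlow, hup⟩ := ncard_simplexPoints_bounds d r hr (Real.log T) hL
  have hp : 0 < ∏ j, r j := Finset.prod_pos fun j _ => hr j
  have hc : 0 < d.factorial * ∏ j, r j := by positivity
  have hform (x : ℝ) : (∏ j, 1 / r j) * x / d.factorial = x / (d.factorial * ∏ j, r j) := by
    rw [Finset.prod_div_distrib, Finset.prod_const_one]
    field_simp
  refine ⟨hf, ?_, ?_⟩
  · rw [hform, div_le_iff₀ hc]
    exact hlow
  · rw [hform, le_div_iff₀ hc]
    exact hup
end

section
/- Let ω, τ > 0 and let r = (r_j)_{j≥1} be positive reals with r_j ≥ ω j^{τ} for all j ≥ 1, and suppose c_{ω,τ} := τ + ω^{−1/τ} log(e/ω) > 0. Then for every real T ≥ 1 the set E(T) := { s ∈ ℤ_+^∞ finitely supported : ∑_{j=1}^{∞} r_j s_j ≤ log T } is finite and |E(T)| ≤ exp( c_{ω,τ} · (log T)^{1/τ} ). -/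
/-- The infinite-dimensional weighted simplex (analytic hyperbolic cross with `m = 0`,
`p = 0`): all finitely supported `s ∈ ℤ_+^∞` with `∑_j r_j s_j ≤ log T`.
The sequence `r` is indexed from `0`, i.e. `r j` is the paper's `r_{j+1}`. -/
def EInfSet (r : ℕ → ℝ) (T : ℝ) : Set (ℕ →₀ ℕ) :=
  {s | (s.sum fun j c => r j * (c : ℝ)) ≤ Real.log T}

/-- The lattice points of the simplex `∑_{j<n} w_j s_j ≤ R`, `s ≥ 0`, as finitely supported
sequences. -/
def latticeSimplex (w : ℕ → ℝ) (n : ℕ) (R : ℝ) : Set (ℕ →₀ ℕ) :=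
  {s | s.support ⊆ Finset.range n ∧ ∑ j ∈ Finset.range n, w j * (s j : ℝ) ≤ R}

theorem latticeSimplex_eq_empty {w : ℕ → ℝ} (hw : ∀ j, 0 < w j) (n : ℕ) {R : ℝ} (hR : R < 0) :
    latticeSimplex w n R = ∅ := by
  ext s
  simp only [latticeSimplex, Set.mem_ofPred_eq, Set.mem_empty_iff_false, iff_false, not_and, not_le]
  intro _
  exact hR.trans_le (Finset.sum_nonneg fun j _ => mul_nonneg (hw j).le (Nat.cast_nonneg _))

theorem latticeSimplex_succ_subset (w : ℕ → ℝ) (n : ℕ) (R : ℝ) :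
    latticeSimplex w (n + 1) R ⊆
      latticeSimplex w n R ∪
        (fun t => t + Finsupp.single n 1) '' latticeSimplex w (n + 1) (R - w n) := by
  rintro s ⟨hs, hsum⟩
  rcases Nat.eq_zero_or_pos (s n) with h0 | hpos
  · left
    refine ⟨fun j hj => ?_, ?_⟩
    · have hj' := Finset.mem_range.1 (hs hj)
      have : j ≠ n := by
        rintro rfl
        exact (Finsupp.mem_support_iff.1 hj) h0
      exact Finset.mem_range.2 (by omega)
    · simpa [Finset.sum_range_succ, h0] using hsum
  · right
    have hle : Finsupp.single n 1 ≤ s := by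
      rw [Finsupp.single_le_iff]
      exact hpos
    refine ⟨s - Finsupp.single n 1, ⟨fun j hj => hs ?_, ?_⟩, tsub_add_cancel_of_le hle⟩
    · rw [Finsupp.mem_support_iff] at hj ⊢
      intro h
      simp [h] at hj
    · rw [Finset.sum_range_succ] at hsum ⊢
      have h1 : ∑ j ∈ Finset.range n, w j * (((s - Finsupp.single n 1 : ℕ →₀ ℕ) j : ℕ) : ℝ) =
          ∑ j ∈ Finset.range n, w j * (s j : ℝ) := by
        refine Finset.sum_congr rfl fun j hj => ?_
        have : n ≠ j := (Finset.mem_range.1 hj).ne'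
        simp [this]
      have h2 : (((s - Finsupp.single n 1 : ℕ →₀ ℕ) n : ℕ) : ℝ) = (s n : ℝ) - 1 := by
        simp [Nat.cast_sub (Nat.succ_le_of_lt hpos)]
      rw [h1, h2]
      linarith

theorem mul_pow_add_pow_succ_le {y w : ℝ} (hy : 0 ≤ y) (hw : 0 ≤ w) (n : ℕ) :
    ((n : ℝ) + 1) * w * y ^ n + y ^ (n + 1) ≤ (y + w) ^ (n + 1) := by
  induction n with
  | zero => simp [add_comm]
  | succ n ih =>
    have h := mul_le_mul_of_nonneg_right ih (add_nonneg hy hw)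
    have h2 : 0 ≤ ((n : ℝ) + 1) * w * y ^ n * w := by positivity
    rw [pow_succ (y + w) (n + 1)]
    push_cast
    refine le_trans ?_ h
    ring_nf at h2 ⊢
    linarith

/-- The number of lattice points of a simplex is at most the volume of the simplex enlarged by a
unit cube. -/
theorem latticeSimplex_finite_and_ncard_le {w : ℕ → ℝ} (hw : ∀ j, 0 < w j) (n : ℕ) :
    ∀ R : ℝ, 0 ≤ R → (latticeSimplex w n R).Finite ∧
      ((latticeSimplex w n R).ncard : ℝ) ≤
        (R + ∑ j ∈ Finset.range n, w j) ^ n / (n.factorial * ∏ j ∈ Finset.range n, w j) := by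
  induction n with
  | zero =>
    intro R _
    have hsub : latticeSimplex w 0 R ⊆ {0} := fun s hs => by
      simpa using hs.1
    refine ⟨(Set.finite_singleton _).subset hsub, ?_⟩
    have := Set.ncard_le_ncard hsub
    simpa using this
  | succ n ih =>
    set W := ∑ j ∈ Finset.range n, w j with hW
    set P := ∏ j ∈ Finset.range n, w j with hP
    have hW0 : 0 ≤ W := Finset.sum_nonneg fun j _ => (hw j).le
    have hP0 : 0 < P := Finset.prod_pos fun j _ => hw j
    have hwn := hw n
    rw [Finset.sum_range_succ, Finset.prod_range_succ, ← hW, ← hP]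
    have key : ∀ m : ℕ, ∀ R : ℝ, -w n ≤ R → R < m * w n →
        (latticeSimplex w (n + 1) R).Finite ∧
        ((latticeSimplex w (n + 1) R).ncard : ℝ) ≤
          (R + (W + w n)) ^ (n + 1) / ((n + 1).factorial * (P * w n)) := by
      have hneg : ∀ R : ℝ, -w n ≤ R → R < 0 → (latticeSimplex w (n + 1) R).Finite ∧
          ((latticeSimplex w (n + 1) R).ncard : ℝ) ≤
            (R + (W + w n)) ^ (n + 1) / ((n + 1).factorial * (P * w n)) := by
        intro R hR hR'
        rw [latticeSimplex_eq_empty hw _ hR']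
        have : 0 ≤ R + (W + w n) := by linarith
        refine ⟨Set.finite_empty, ?_⟩
        rw [Set.ncard_empty, Nat.cast_zero]
        positivity
      intro m
      induction m with
      | zero =>
        intro R hR hR'
        exact hneg R hR (by simpa using hR')
      | succ m ihm =>
        intro R hR hR'
        rcases lt_or_ge R 0 with h0 | h0
        · exact hneg R hR h0
        obtain ⟨hf1, hc1⟩ := ih R h0
        obtain ⟨hf2, hc2⟩ := ihm (R - w n) (by linarith) (by push_cast at hR'; linarith)
        have hsub := latticeSimplex_succ_subset w n R
        have hfin := hf1.union (hf2.image (fun t => t + Finsupp.single n 1))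
        refine ⟨hfin.subset hsub, ?_⟩
        have hcard : (latticeSimplex w (n + 1) R).ncard ≤
            (latticeSimplex w n R).ncard + (latticeSimplex w (n + 1) (R - w n)).ncard :=
          (Set.ncard_le_ncard hsub hfin).trans ((Set.ncard_union_le _ _).trans
            (Nat.add_le_add_left (Set.ncard_image_le hf2) _))
        have hcard' : ((latticeSimplex w (n + 1) R).ncard : ℝ) ≤
            (latticeSimplex w n R).ncard + (latticeSimplex w (n + 1) (R - w n)).ncard := by
          exact_mod_cast hcard
        have hpow := mul_pow_add_pow_succ_le (add_nonneg h0 hW0) hwn.le n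
        have hfac : (0 : ℝ) < n.factorial := by exact_mod_cast n.factorial_pos
        calc _ ≤ _ := hcard'
          _ ≤ _ := add_le_add hc1 hc2
          _ = (((n : ℝ) + 1) * w n * (R + W) ^ n + (R + W) ^ (n + 1)) /
              ((n + 1).factorial * (P * w n)) := by
            rw [Nat.factorial_succ, show R - w n + (W + w n) = R + W by ring]
            push_cast
            field_simp
          _ ≤ _ := by
            rw [← add_assoc]
            gcongr
    intro R hR
    obtain ⟨m, hm⟩ := exists_nat_gt (R / w n)
    exact key m R (by linarith) ((div_lt_iff₀ hwn).1 hm)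

theorem succ_pow_le_exp_mul_factorial (n : ℕ) :
    ((n : ℝ) + 1) ^ n ≤ Real.exp n * n.factorial := by
  induction n with
  | zero => simp
  | succ n ih =>
    have hn : (0 : ℝ) < (n : ℝ) + 1 := by positivity
    have h1 : (1 + 1 / ((n : ℝ) + 1)) ^ (n + 1) ≤ Real.exp 1 := by
      calc (1 + 1 / ((n : ℝ) + 1)) ^ (n + 1) ≤ Real.exp (1 / ((n : ℝ) + 1)) ^ (n + 1) := by
            gcongr
            rw [add_comm]
            exact Real.add_one_le_exp _
        _ = Real.exp 1 := by
            rw [← Real.exp_nat_mul]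
            congr 1
            push_cast
            field_simp
    calc (((n + 1 : ℕ) : ℝ) + 1) ^ (n + 1)
        = (1 + 1 / ((n : ℝ) + 1)) ^ (n + 1) * (((n : ℝ) + 1) * ((n : ℝ) + 1) ^ n) := by
          rw [← pow_succ', ← mul_pow]
          congr 1
          push_cast
          field_simp
      _ ≤ Real.exp 1 * (((n : ℝ) + 1) * (Real.exp n * n.factorial)) := by gcongr
      _ = Real.exp (n + 1 : ℕ) * (n + 1).factorial := by
          rw [Nat.factorial_succ]
          push_cast
          rw [Real.exp_add]
          ring

theorem prod_range_succ_rpow (τ : ℝ) (n : ℕ) :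
    ∏ j ∈ Finset.range n, ((j : ℝ) + 1) ^ τ = (n.factorial : ℝ) ^ τ := by
  rw [Real.finsetProd_rpow _ _ fun j _ => by positivity, ← Finset.prod_range_add_one_eq_factorial]
  push_cast
  rfl

theorem latticeSimplex_rpow_finite_and_ncard_le {τ : ℝ} (hτ : 0 < τ) {N : ℝ} (hN : 0 ≤ N) :
    (latticeSimplex (fun j => ((j : ℝ) + 1) ^ τ) ⌊N⌋₊ (N ^ τ)).Finite ∧
      ((latticeSimplex (fun j => ((j : ℝ) + 1) ^ τ) ⌊N⌋₊ (N ^ τ)).ncard : ℝ) ≤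
        Real.exp ((τ + 1) * N) := by
  obtain ⟨hfin, hcard⟩ := latticeSimplex_finite_and_ncard_le
    (w := fun j => ((j : ℝ) + 1) ^ τ) (fun j => by positivity) ⌊N⌋₊ (N ^ τ) (by positivity)
  refine ⟨hfin, hcard.trans ?_⟩
  have hnN : (⌊N⌋₊ : ℝ) ≤ N := Nat.floor_le hN
  set n := ⌊N⌋₊
  have hfac : (0 : ℝ) < n.factorial := by exact_mod_cast n.factorial_pos
  have hsum : ∑ j ∈ Finset.range n, ((j : ℝ) + 1) ^ τ ≤ n * N ^ τ := by
    have := Finset.sum_le_card_nsmul (Finset.range n) (fun j : ℕ => ((j : ℝ) + 1) ^ τ) (N ^ τ) ?_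
    · simpa using this
    intro j hj
    have hj' : (j : ℝ) + 1 ≤ n := by exact_mod_cast Finset.mem_range.1 hj
    exact Real.rpow_le_rpow (by positivity) (hj'.trans hnN) hτ.le
  have hsum0 : 0 ≤ ∑ j ∈ Finset.range n, ((j : ℝ) + 1) ^ τ :=
    Finset.sum_nonneg fun j _ => by positivity
  rw [prod_range_succ_rpow]
  calc (N ^ τ + ∑ j ∈ Finset.range n, ((j : ℝ) + 1) ^ τ) ^ n / (n.factorial * (n.factorial : ℝ) ^ τ)
      ≤ (((n : ℝ) + 1) * N ^ τ) ^ n / (n.factorial * (n.factorial : ℝ) ^ τ) := by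
        gcongr
        linarith
    _ = ((n : ℝ) + 1) ^ n / n.factorial * (N ^ n / n.factorial) ^ τ := by
        rw [mul_pow, Real.div_rpow (by positivity) hfac.le, ← Real.rpow_natCast (N ^ τ) n,
          ← Real.rpow_natCast N n, ← Real.rpow_mul hN, ← Real.rpow_mul hN, mul_comm τ]
        field_simp
    _ ≤ Real.exp N * Real.exp N ^ τ := by
        gcongr
        · rw [div_le_iff₀ hfac]
          exact (succ_pow_le_exp_mul_factorial n).trans (by gcongr)
        · exact Real.pow_div_factorial_le_exp N hN n
    _ = Real.exp ((τ + 1) * N) := by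
        rw [← Real.exp_mul, ← Real.exp_add]
        congr 1
        ring

theorem EInfSet_subset_latticeSimplex {ω τ : ℝ} (hω : 0 < ω) (hτ : 0 < τ) {r : ℕ → ℝ}
    (hr : ∀ j : ℕ, ω * ((j : ℝ) + 1) ^ τ ≤ r j) {T N : ℝ} (hN : 0 ≤ N)
    (hNT : N ^ τ = Real.log T / ω) :
    EInfSet r T ⊆ latticeSimplex (fun j => ((j : ℝ) + 1) ^ τ) ⌊N⌋₊ (N ^ τ) := by
  intro s hs
  have hsum : ∑ j ∈ s.support, ((j : ℝ) + 1) ^ τ * (s j : ℝ) ≤ N ^ τ := by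
    rw [hNT, le_div_iff₀ hω, Finset.sum_mul]
    refine le_trans (Finset.sum_le_sum fun j _ => ?_) hs
    calc ((j : ℝ) + 1) ^ τ * (s j : ℝ) * ω = ω * ((j : ℝ) + 1) ^ τ * (s j : ℝ) := by ring
      _ ≤ r j * (s j : ℝ) := by
        gcongr
        exact hr j
  have hsupp : s.support ⊆ Finset.range ⌊N⌋₊ := by
    intro j hj
    have h1 : (1 : ℝ) ≤ s j := by
      exact_mod_cast Nat.one_le_iff_ne_zero.2 (Finsupp.mem_support_iff.1 hj)
    have h2 : ((j : ℝ) + 1) ^ τ ≤ N ^ τ :=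
      calc ((j : ℝ) + 1) ^ τ ≤ ((j : ℝ) + 1) ^ τ * (s j : ℝ) :=
            le_mul_of_one_le_right (by positivity) h1
        _ ≤ _ := Finset.single_le_sum (f := fun j : ℕ => ((j : ℝ) + 1) ^ τ * (s j : ℝ))
            (fun i _ => by positivity) hj
        _ ≤ N ^ τ := hsum
    have h3 : (j : ℝ) + 1 ≤ N := (Real.rpow_le_rpow_iff (by positivity) hN hτ).1 h2
    exact Finset.mem_range.2 (Nat.le_floor (by exact_mod_cast h3))
  refine ⟨hsupp, ?_⟩
  rw [← Finset.sum_subset hsupp fun j _ hj => by simp [Finsupp.notMem_support_iff.1 hj]]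
  exact hsum

theorem add_one_mul_rpow_le {ω τ L : ℝ} (hω : 0 < ω) (hτ : 0 < τ) (hL : 0 ≤ L) :
    (τ + 1) * (L / ω) ^ (1 / τ) ≤
      (τ + ω ^ (-1 / τ) * Real.log (Real.exp 1 / ω)) * L ^ (1 / τ) := by
  set u := ω ^ (1 / τ) with hu
  have hu0 : 0 < u := by positivity
  have hlog : Real.log ω = τ * Real.log u := by
    rw [hu, Real.log_rpow hω]
    field_simp
  have hinv : ω ^ (-1 / τ) = u⁻¹ := by rw [neg_div, Real.rpow_neg hω.le]
  rw [Real.div_rpow hL hω.le, ← hu, hinv, Real.log_div (Real.exp_pos 1).ne' hω.ne', Real.log_exp,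
    hlog]
  have h1 : Real.log u ≤ u - 1 := Real.log_le_sub_one_of_pos hu0
  have h2 : τ + 1 ≤ τ * u + (1 - τ * Real.log u) := by nlinarith
  calc (τ + 1) * (L ^ (1 / τ) / u)
      ≤ (τ * u + (1 - τ * Real.log u)) * (L ^ (1 / τ) / u) := by gcongr
    _ = _ := by field_simp

/-- **Lemma.** Let `ω, τ > 0`, let `r_j ≥ ω j^τ` for all `j ≥ 1`, and suppose
`c_{ω,τ} = τ + ω^{-1/τ} log(e/ω) > 0`. Then for every `T ≥ 1` the set `E(T)` is
finite and `|E(T)| ≤ exp(c_{ω,τ} (log T)^{1/τ})`. -/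
theorem card_EInfSet_le (ω τ : ℝ) (hω : 0 < ω) (hτ : 0 < τ)
    (r : ℕ → ℝ) (hrpos : ∀ j, 0 < r j)
    (hr : ∀ j : ℕ, ω * ((j : ℝ) + 1) ^ τ ≤ r j)
    (hc : 0 < τ + ω ^ (-1 / τ) * Real.log (Real.exp 1 / ω))
    (T : ℝ) (hT : 1 ≤ T) :
    (EInfSet r T).Finite ∧
    (Nat.card (EInfSet r T) : ℝ) ≤
      Real.exp ((τ + ω ^ (-1 / τ) * Real.log (Real.exp 1 / ω)) *
        (Real.log T) ^ (1 / τ)) := by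
  have hL : 0 ≤ Real.log T := Real.log_nonneg hT
  have hM : 0 ≤ Real.log T / ω := div_nonneg hL hω.le
  have hN : 0 ≤ (Real.log T / ω) ^ (1 / τ) := Real.rpow_nonneg hM _
  have hNT : ((Real.log T / ω) ^ (1 / τ)) ^ τ = Real.log T / ω := by
    rw [← Real.rpow_mul hM, one_div_mul_cancel hτ.ne', Real.rpow_one]
  have hsub := EInfSet_subset_latticeSimplex hω hτ hr hN hNT
  obtain ⟨hfin, hcard⟩ := latticeSimplex_rpow_finite_and_ncard_le hτ hN
  refine ⟨hfin.subset hsub, ?_⟩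
  rw [Nat.card_coe_set_eq]
  calc ((EInfSet r T).ncard : ℝ) ≤ _ := by exact_mod_cast Set.ncard_le_ncard hsub hfin
    _ ≤ _ := hcard
    _ ≤ _ := Real.exp_le_exp.2 (add_one_mul_rpow_le hω hτ hL)
end

section
/- (Upper bound for the ε-dimension.) Let ι be a countable index set, let w : ι → ℝ be a weight with w(i) > 0 for all i, let ε ∈ (0,1], and assume the set G := { i ∈ ι : w(i) ≤ 1/ε } is finite, with cardinality n := |G|. Then there exists a submodule M of the Hilbert space ℓ²(ι) with finite dimension dim M ≤ n (namely the span of the coordinate unit vectors e_i for i ∈ G) such that every g ∈ ℓ²(ι) with ∑_{i∈ι} w(i)²|g_i|² ≤ 1 satisfies inf_{h ∈ M} ‖g − h‖_{ℓ²} ≤ ε. -/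
open scoped ENNReal

/-- The error of truncating an element of `ℓ²(ι)` to finitely many coordinates is at most `ε` on
the `w`-weighted unit ball, provided that `1 ≤ ε * w i` at all discarded coordinates. -/
theorem norm_sub_sum_single_le {ι : Type*} [DecidableEq ι] {w : ι → ℝ} {ε : ℝ} (hε : 0 ≤ ε)
    (s : Finset ι) (hs : ∀ i ∉ s, 1 ≤ ε * w i) (g : lp (fun _ : ι => ℂ) 2)
    (hg : ∑' i : ι, ENNReal.ofReal ((w i) ^ 2 * ‖g i‖ ^ 2) ≤ 1) :
    ‖g - ∑ i ∈ s, lp.single 2 i (g i)‖ ≤ ε := by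
  have coord (i : ι) : ‖(g - ∑ j ∈ s, lp.single 2 j (g j) : lp (fun _ : ι => ℂ) 2) i‖ ^ 2
      ≤ ε ^ 2 * ((w i) ^ 2 * ‖g i‖ ^ 2) := by
    have trunc : (∑ j ∈ s, lp.single 2 j (g j) : lp (fun _ : ι => ℂ) 2) i
        = if i ∈ s then g i else 0 := by
      rw [lp.coeFn_sum, Finset.sum_apply]
      simp [Pi.single_apply]
    rw [lp.coeFn_sub, Pi.sub_apply, trunc]
    split_ifs with hi
    · rw [sub_self, norm_zero, zero_pow two_ne_zero]
      positivity
    · rw [sub_zero, ← mul_assoc, ← mul_pow]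
      exact le_mul_of_one_le_left (by positivity) (one_le_pow₀ (hs i hi))
  refine lp.norm_le_of_forall_sum_le (by simp) hε fun t => ?_
  simp only [ENNReal.toReal_ofNat, Real.rpow_ofNat]
  have weighted : ∑ i ∈ t, (w i) ^ 2 * ‖g i‖ ^ 2 ≤ 1 := by
    rw [← ENNReal.ofReal_le_one, ENNReal.ofReal_sum_of_nonneg fun i _ => by positivity]
    exact (ENNReal.sum_le_tsum t).trans hg
  calc _ ≤ ∑ i ∈ t, ε ^ 2 * ((w i) ^ 2 * ‖g i‖ ^ 2) := Finset.sum_le_sum fun i _ => coord i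
    _ = ε ^ 2 * ∑ i ∈ t, (w i) ^ 2 * ‖g i‖ ^ 2 := (Finset.mul_sum ..).symm
    _ ≤ ε ^ 2 := mul_le_of_le_one_right (by positivity) weighted

/-- **Upper bound for the ε-dimension.**
If `G = {i : w i ≤ 1/ε}` is finite with cardinality `n`, then there is a submodule
`M` of `ℓ²(ι)` of finite dimension at most `n` such that every `g` in the
`w`-weighted unit ball is approximated within `ε` by `M` in the `ℓ²`-norm. -/
theorem epsilon_dimension_upper {ι : Type*} [Countable ι] (w : ι → ℝ)
    (hw : ∀ i, 0 < w i) (ε : ℝ) (hε0 : 0 < ε) (hε1 : ε ≤ 1)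
    (hfin : {i : ι | w i ≤ 1 / ε}.Finite) :
    ∃ M : Submodule ℂ (lp (fun _ : ι => ℂ) 2),
      FiniteDimensional ℂ M ∧
      Module.finrank ℂ M ≤ Nat.card {i : ι | w i ≤ 1 / ε} ∧
      ∀ g : lp (fun _ : ι => ℂ) 2,
        (∑' i : ι, ENNReal.ofReal ((w i) ^ 2 * ‖g i‖ ^ 2)) ≤ 1 →
        (⨅ h : M, ‖g - (h : lp (fun _ : ι => ℂ) 2)‖) ≤ ε := by
  classical
  let e : ι → lp (fun _ : ι => ℂ) 2 := fun i => lp.single 2 i 1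
  refine ⟨Submodule.span ℂ (hfin.toFinset.image e : Finset (lp (fun _ : ι => ℂ) 2)),
    FiniteDimensional.span_finset ℂ _, ?_, fun g hg => ?_⟩
  · rw [Nat.card_coe_set_eq, Set.ncard_eq_toFinset_card _ hfin]
    exact (finrank_span_finset_le_card _).trans Finset.card_image_le
  · have mem : ∑ i ∈ hfin.toFinset, lp.single 2 i (g i) ∈
        Submodule.span ℂ (hfin.toFinset.image e : Finset (lp (fun _ : ι => ℂ) 2)) := by
      refine Submodule.sum_mem _ fun i hi => ?_
      have : lp.single 2 i (g i) = g i • e i := by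
        rw [← lp.single_smul, smul_eq_mul, mul_one]
      rw [this]
      exact Submodule.smul_mem _ _ (Submodule.subset_span (Finset.mem_image_of_mem e hi))
    have large : ∀ i ∉ hfin.toFinset, 1 ≤ ε * w i := fun i hi => by
      rw [Set.Finite.mem_toFinset, Set.mem_ofPred_eq, not_le, div_lt_iff₀' hε0] at hi
      exact hi.le
    have bdd : BddBelow (Set.range fun h : Submodule.span ℂ
        (hfin.toFinset.image e : Set (lp (fun _ : ι => ℂ) 2)) =>
          ‖g - (h : lp (fun _ : ι => ℂ) 2)‖) :=
      ⟨0, Set.forall_mem_range.2 fun _ => norm_nonneg _⟩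
    have approx := norm_sub_sum_single_le hε0.le hfin.toFinset large g hg
    exact ciInf_le_of_le bdd ⟨_, mem⟩ approx
end

section
/- (Lower bound for the ε-dimension.) Let ι be a countable index set, let w : ι → ℝ be a weight with w(i) > 0 for all i, let ε ∈ (0,1], and assume the set G := { i ∈ ι : w(i) ≤ 1/ε } is finite, with cardinality n := |G| ≥ 2. Then for every submodule M of the Hilbert space ℓ²(ι) with finite dimension dim M ≤ n − 2, there holds sup { inf_{h ∈ M} ‖g − h‖_{ℓ²} : g ∈ ℓ²(ι), ∑_{i∈ι} w(i)²|g_i|² ≤ 1 } ≥ ε. -/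
open scoped ENNReal

/-- A linear map from a space of dimension larger than `dim M` sends some nonzero vector
into the orthogonal complement of `M`. -/
theorem exists_ne_zero_map_mem_orthogonal {E H : Type*} [AddCommGroup E] [Module ℂ E]
    [FiniteDimensional ℂ E] [NormedAddCommGroup H] [InnerProductSpace ℂ H]
    (T : E →ₗ[ℂ] H) (M : Submodule ℂ H) [FiniteDimensional ℂ M]
    (hM : Module.finrank ℂ M < Module.finrank ℂ E) :
    ∃ x : E, x ≠ 0 ∧ T x ∈ Mᗮ := by
  have hker := LinearMap.ker_ne_bot_of_finrank_lt
    (f := (M.orthogonalProjectionOnto : H →ₗ[ℂ] M) ∘ₗ T) hM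
  obtain ⟨x, hx, hx0⟩ := Submodule.exists_mem_ne_zero_of_ne_bot hker
  refine ⟨x, hx0, ?_⟩
  rw [← Submodule.orthogonalProjectionOnto_eq_zero_iff]
  simpa using hx

/-- A vector orthogonal to `M` has `0` as its best approximation in `M`. -/
theorem norm_le_iInf_norm_sub_of_mem_orthogonal {H : Type*} [NormedAddCommGroup H]
    [InnerProductSpace ℂ H] {M : Submodule ℂ H} {g : H} (hg : g ∈ Mᗮ) :
    ‖g‖ ≤ ⨅ h : M, ‖g - (h : H)‖ := by
  refine le_ciInf fun h => ?_
  have hpyth := norm_sub_sq (𝕜 := ℂ) g (h : H)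
  rw [Submodule.inner_left_of_mem_orthogonal h.2 hg] at hpyth
  simp only [map_zero, mul_zero, sub_zero] at hpyth
  nlinarith [norm_nonneg (g - (h : H)), norm_nonneg g, mul_self_nonneg ‖(h : H)‖]

/-- The extension by zero of a coefficient vector on a finite set to `ℓ²`. -/
noncomputable def lpExtendByZero {ι : Type*} [DecidableEq ι] (s : Finset ι) :
    (s → ℂ) →ₗ[ℂ] lp (fun _ : ι => ℂ) 2 where
  toFun c := ⟨fun j => if hj : j ∈ s then c ⟨j, hj⟩ else 0,
    (memℓp_zero (s.finite_toSet.subset fun j hj => by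
      by_contra h
      exact hj (dif_neg h))).of_exponent_ge zero_le⟩
  map_add' c d := by
    ext j
    rw [lp.coeFn_add, Pi.add_apply]
    by_cases hj : j ∈ s <;> simp [hj]
  map_smul' a c := by
    ext j
    by_cases hj : j ∈ s <;> simp [hj]

theorem lpExtendByZero_apply_mem {ι : Type*} [DecidableEq ι] (s : Finset ι) (c : s → ℂ)
    (i : s) : lpExtendByZero s c (i : ι) = c i :=
  dif_pos i.2

theorem lpExtendByZero_apply_notMem {ι : Type*} [DecidableEq ι] (s : Finset ι) (c : s → ℂ)
    {j : ι} (hj : j ∉ s) : lpExtendByZero s c j = 0 :=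
  dif_neg hj

/-- If `g` is supported where the weight is at most `C`, its squared weighted norm is at most
`C ^ 2 * ‖g‖ ^ 2`. -/
theorem tsum_weight_mul_sq_le {ι : Type*} {w : ι → ℝ} (hw : ∀ i, 0 ≤ w i) {C : ℝ}
    (g : lp (fun _ : ι => ℂ) 2) (hg : ∀ i, C < w i → g i = 0) :
    ∑' i : ι, ENNReal.ofReal (w i ^ 2 * ‖g i‖ ^ 2) ≤ ENNReal.ofReal (C ^ 2 * ‖g‖ ^ 2) := by
  have hsum : HasSum (fun i => ‖g i‖ ^ 2) (‖g‖ ^ 2) := by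
    simpa using lp.hasSum_norm (p := 2) (by norm_num) g
  have hsumC := hsum.mul_left (C ^ 2)
  rw [← hsumC.tsum_eq, ENNReal.ofReal_tsum_of_nonneg (fun i => by positivity) hsumC.summable]
  refine ENNReal.tsum_le_tsum fun i => ENNReal.ofReal_le_ofReal ?_
  rcases lt_or_ge C (w i) with hi | hi
  · simp [hg i hi]
  · have := hw i
    gcongr

/-- **Lower bound for the ε-dimension.**
If `G = {i : w i ≤ 1/ε}` is finite with cardinality `n ≥ 2`, then no submodule `M`
of `ℓ²(ι)` of finite dimension at most `n - 2` approximates the whole `w`-weighted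
unit ball within `ε`: there is an element `g` of the ball whose `ℓ²`-distance to `M`
is at least `ε` (so the sup over the ball of the distance to `M` is `≥ ε`). -/
theorem epsilon_dimension_lower {ι : Type*} [Countable ι] (w : ι → ℝ)
    (hw : ∀ i, 0 < w i) (ε : ℝ) (hε0 : 0 < ε) (hε1 : ε ≤ 1)
    (hfin : {i : ι | w i ≤ 1 / ε}.Finite)
    (hn : 2 ≤ Nat.card {i : ι | w i ≤ 1 / ε}) :
    ∀ M : Submodule ℂ (lp (fun _ : ι => ℂ) 2),
      FiniteDimensional ℂ M →
      Module.finrank ℂ M ≤ Nat.card {i : ι | w i ≤ 1 / ε} - 2 →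
      ∃ g : lp (fun _ : ι => ℂ) 2,
        (∑' i : ι, ENNReal.ofReal ((w i) ^ 2 * ‖g i‖ ^ 2)) ≤ 1 ∧
        ε ≤ ⨅ h : M, ‖g - (h : lp (fun _ : ι => ℂ) 2)‖ := by
  classical
  intro M hMfin hM
  set s : Finset ι := hfin.toFinset with hs
  have hcard : Nat.card {i : ι | w i ≤ 1 / ε} = s.card :=
    Nat.card_eq_card_finite_toFinset hfin
  obtain ⟨c, hc0, hc⟩ := exists_ne_zero_map_mem_orthogonal (lpExtendByZero s) M (by
    rw [Module.finrank_fintype_fun_eq_card, Fintype.card_coe]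
    omega)
  set f := lpExtendByZero s c with hf
  have hf0 : f ≠ 0 := by
    intro h
    refine hc0 (funext fun i => ?_)
    rw [← lpExtendByZero_apply_mem s c i, ← hf, h]
    simp
  have hfsupp : ∀ i, 1 / ε < w i → f i = 0 := fun i hi =>
    lpExtendByZero_apply_notMem s c (by simpa [hs] using hi)
  set g := ((ε / ‖f‖ : ℝ) : ℂ) • f with hg
  have hgnorm : ‖g‖ = ε := by
    have := norm_pos_iff.mpr hf0
    rw [hg, norm_smul, Complex.norm_real, Real.norm_of_nonneg (by positivity),
      div_mul_cancel₀ _ this.ne']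
  refine ⟨g, ?_, ?_⟩
  · refine (tsum_weight_mul_sq_le (C := 1 / ε) (fun i => (hw i).le) g
      fun i hi => ?_).trans ?_
    · simp [hg, hfsupp i hi]
    · rw [hgnorm, ← mul_pow, one_div_mul_cancel hε0.ne']
      simp
  · rw [← hgnorm]
    exact norm_le_iInf_norm_sub_of_mem_orthogonal (Mᗮ.smul_mem _ hc)
end

section
/- (Main ε-dimension theorem, Sobolev-analytic case, p = 0.) Let m ∈ ℕ with m ≥ 1, α > β ≥ 0, a := α − β, and let r = (r_j)_{j≥1} be positive reals with M_0(m) := ∑_{j=1}^{∞} 1/(e^{m r_j/a} − 1) < ∞. Let ι := ℤ_+^m × { s ∈ ℤ_+^∞ : s finitely supported } and define the weight w(k,s) := max_{1≤j≤m}(1+k_j)^{α−β} · exp(∑_{j=1}^{∞} r_j s_j) on ι. Then for every ε ∈ (0,1]: (i) there exists a submodule M of ℓ²(ι) with dim M ≤ (3/2)^{2m} · exp(M_0(m)) · ε^{−m/(α−β)} such that every g ∈ ℓ²(ι) with ∑_{i∈ι} w(i)² |g_i|² ≤ 1 satisfies inf_{h∈M} ‖g − h‖_{ℓ²} ≤ ε;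 and (ii) every submodule M of ℓ²(ι) with dim M ≤ ⌊ε^{−1/(α−β)}⌋^m − 2 satisfies sup { inf_{h∈M} ‖g−h‖_{ℓ²} : ∑_{i} w(i)²|g_i|² ≤ 1 } ≥ ε. -/
open scoped ENNReal

/-- The index set of the Sobolev-analytic setting: `ℤ_+^m × ℤ_+^∞` with finitely
supported second component. -/
abbrev SAIndex (m : ℕ) : Type := (Fin m → ℕ) × (ℕ →₀ ℕ)

/-- The weight `w(k,s) = max_{1≤j≤m}(1+k_j)^{α-β} · exp(∑_j r_j s_j)` of the
Sobolev-analytic setting (case `p = 0`). -/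
noncomputable def saWeight (m : ℕ) (α β : ℝ) (r : ℕ → ℝ) (i : SAIndex m) : ℝ :=
  ((Finset.univ.sup (fun j => 1 + i.1 j) : ℕ) : ℝ) ^ (α - β) *
    Real.exp (i.2.sum fun j c => r j * c)

open scoped InnerProductSpace

/-- If `w ≥ 1/ε` off a finite set `S` of indices, then the coordinate subspace of `S` approximates
the `w`-weighted unit ball of `ℓ²` within `ε`. -/
theorem exists_submodule_approx_weighted_ball {ι : Type*} (w : ι → ℝ) {ε : ℝ}
    (hε : 0 < ε) (S : Finset ι) (hS : ∀ i ∉ S, 1 ≤ ε * w i) :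
    ∃ M : Submodule ℂ (lp (fun _ : ι => ℂ) 2),
      FiniteDimensional ℂ M ∧ Module.finrank ℂ M ≤ S.card ∧
      ∀ g : lp (fun _ : ι => ℂ) 2,
        (∑' i, ENNReal.ofReal ((w i) ^ 2 * ‖g i‖ ^ 2)) ≤ 1 →
        (⨅ h : M, ‖g - (h : lp (fun _ : ι => ℂ) 2)‖) ≤ ε := by
  classical
  let e : ι → lp (fun _ : ι => ℂ) 2 := fun i => lp.single 2 i (1 : ℂ)
  let M : Submodule ℂ (lp (fun _ : ι => ℂ) 2) := Submodule.span ℂ (S.image e : Finset _)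
  refine ⟨M, FiniteDimensional.span_finset ℂ (S.image e),
    (finrank_span_finset_le_card (S.image e)).trans Finset.card_image_le, fun g hg => ?_⟩
  let h : lp (fun _ : ι => ℂ) 2 := ∑ i ∈ S, g i • e i
  have hmem : h ∈ M :=
    Submodule.sum_mem _ fun i hi => Submodule.smul_mem _ _
      (Submodule.subset_span (Finset.mem_coe.2 (Finset.mem_image_of_mem e hi)))
  have hcoord : ∀ i, h i = if i ∈ S then g i else 0 := by
    intro i
    simp only [h, e, lp.coeFn_sum, Finset.sum_apply, lp.coeFn_smul, Pi.smul_apply, lp.single_apply]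
    simp [Pi.single_apply]
  refine (ciInf_le ⟨0, ?_⟩ (⟨h, hmem⟩ : M)).trans ?_
  · rintro _ ⟨x, rfl⟩
    exact norm_nonneg _
  refine lp.norm_le_of_forall_sum_le (by norm_num) hε.le fun s => ?_
  have hsum : ∑ i ∈ s, (w i) ^ 2 * ‖g i‖ ^ 2 ≤ 1 := by
    have h1 := (ENNReal.sum_le_tsum s).trans hg
    rw [← ENNReal.ofReal_sum_of_nonneg (fun i _ => by positivity)] at h1
    exact ENNReal.ofReal_le_one.1 h1
  have hpt : ∀ i, ‖(g - h) i‖ ^ 2 ≤ ε ^ 2 * ((w i) ^ 2 * ‖g i‖ ^ 2) := by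
    intro i
    rw [lp.coeFn_sub, Pi.sub_apply, hcoord]
    split_ifs with hi
    · rw [sub_self, norm_zero, zero_pow two_ne_zero]
      positivity
    · have h1 : 1 ≤ (ε * w i) ^ 2 := one_le_pow₀ (hS i hi)
      rw [sub_zero]
      nlinarith [mul_le_mul_of_nonneg_right h1 (sq_nonneg ‖g i‖)]
  simp only [ENNReal.toReal_ofNat, Real.rpow_ofNat]
  calc ∑ i ∈ s, ‖(g - h) i‖ ^ 2 ≤ ∑ i ∈ s, ε ^ 2 * ((w i) ^ 2 * ‖g i‖ ^ 2) :=
        Finset.sum_le_sum fun i _ => hpt i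
    _ = ε ^ 2 * ∑ i ∈ s, (w i) ^ 2 * ‖g i‖ ^ 2 := by rw [Finset.mul_sum]
    _ ≤ ε ^ 2 := mul_le_of_le_one_right (by positivity) hsum

/-- If `0 ≤ w ≤ 1/ε` on a finite set `S` of indices, then no subspace of `ℓ²` of dimension less
than `S.card` approximates the `w`-weighted unit ball better than `ε`. -/
theorem exists_mem_weighted_ball_le_dist {ι : Type*} (w : ι → ℝ) {ε : ℝ}
    (hε : 0 < ε) (S : Finset ι) (hw : ∀ i ∈ S, 0 ≤ w i) (hS : ∀ i ∈ S, ε * w i ≤ 1)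
    (M : Submodule ℂ (lp (fun _ : ι => ℂ) 2)) [FiniteDimensional ℂ M]
    (hM : Module.finrank ℂ M < S.card) :
    ∃ g : lp (fun _ : ι => ℂ) 2,
      (∑' i, ENNReal.ofReal ((w i) ^ 2 * ‖g i‖ ^ 2)) ≤ 1 ∧
      ε ≤ ⨅ h : M, ‖g - (h : lp (fun _ : ι => ℂ) 2)‖ := by
  classical
  let L : (S → ℂ) →ₗ[ℂ] lp (fun _ : ι => ℂ) 2 :=
    Fintype.linearCombination ℂ (fun i : S => lp.single 2 (i : ι) (1 : ℂ))
  have hLin : ∀ c (i : S), L c i = c i := by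
    intro c i
    simp only [L, Fintype.linearCombination_apply, lp.coeFn_sum, Finset.sum_apply, lp.coeFn_smul,
      Pi.smul_apply, lp.single_apply]
    simp [Pi.single_apply]
  have hLout : ∀ c, ∀ i ∉ S, L c i = 0 := by
    intro c i hi
    simp only [L, Fintype.linearCombination_apply, lp.coeFn_sum, Finset.sum_apply, lp.coeFn_smul,
      Pi.smul_apply, lp.single_apply]
    refine Finset.sum_eq_zero fun j _ => ?_
    have hij : i ≠ j := fun hij => hi (hij ▸ j.2)
    rw [Pi.single_eq_of_ne hij, smul_zero]
  obtain ⟨c, hc, hc0⟩ := (Submodule.ne_bot_iff _).1 <|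
    LinearMap.ker_ne_bot_of_finrank_lt (f := M.orthogonalProjectionOnto.toLinearMap ∘ₗ L)
      (by simpa using hM)
  have hv : L c ∈ Mᗮ := by
    rw [← Submodule.orthogonalProjectionOnto_eq_zero_iff]
    simpa using hc
  have hv0 : L c ≠ 0 := fun h0 => hc0 <| funext fun i => by
    rw [← hLin c i, h0]
    rfl
  have hn : 0 < ‖L c‖ := norm_pos_iff.2 hv0
  let g : lp (fun _ : ι => ℂ) 2 := ((ε / ‖L c‖ : ℝ) : ℂ) • L c
  have hgn : ‖g‖ = ε := by
    rw [norm_smul, Complex.norm_real, Real.norm_of_nonneg (by positivity)]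
    field_simp
  have hg : g ∈ Mᗮ := Submodule.smul_mem _ _ hv
  have hgout : ∀ i ∉ S, g i = 0 := fun i hi => by
    simp only [g, lp.coeFn_smul, Pi.smul_apply, hLout c i hi, smul_zero]
  refine ⟨g, ?_, le_ciInf fun h => ?_⟩
  · rw [tsum_eq_sum (s := S) fun i hi => by simp [hgout i hi],
      ← ENNReal.ofReal_sum_of_nonneg (fun i _ => by positivity), ENNReal.ofReal_le_one]
    have h2 := lp.sum_rpow_le_norm_rpow (p := 2) (by norm_num) g S
    simp only [ENNReal.toReal_ofNat, Real.rpow_ofNat, hgn] at h2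
    have hpt : ∀ i ∈ S, ε ^ 2 * ((w i) ^ 2 * ‖g i‖ ^ 2) ≤ ‖g i‖ ^ 2 := by
      intro i hi
      have h1 : (ε * w i) ^ 2 ≤ 1 := pow_le_one₀ (mul_nonneg hε.le (hw i hi)) (hS i hi)
      nlinarith [mul_le_mul_of_nonneg_right h1 (sq_nonneg ‖g i‖)]
    have h3 := (Finset.sum_le_sum hpt).trans h2
    rw [← Finset.mul_sum] at h3
    exact (mul_le_iff_le_one_right (by positivity)).1 h3
  · have horth : ⟪g, (h : lp (fun _ : ι => ℂ) 2)⟫_ℂ = 0 :=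
      Submodule.inner_left_of_mem_orthogonal h.2 hg
    have hp : ‖g - h‖ * ‖g - h‖ = ‖g‖ * ‖g‖ +
        ‖(h : lp (fun _ : ι => ℂ) 2)‖ * ‖(h : lp (fun _ : ι => ℂ) 2)‖ := by
      have hneg : ⟪g, -(h : lp (fun _ : ι => ℂ) 2)⟫_ℂ = 0 := by rw [inner_neg_right, horth, neg_zero]
      rw [sub_eq_add_neg, norm_add_sq_eq_norm_sq_add_norm_sq_of_inner_eq_zero _ _ hneg, norm_neg]
    rw [← hgn]
    nlinarith [norm_nonneg (g - h), norm_nonneg g, mul_self_nonneg ‖(h : lp (fun _ : ι => ℂ) 2)‖]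

/-- Finite partial sums of `∑_s exp (-∑_j t_j s_j)` over finitely supported `s` are bounded by
`exp (∑_j 1 / (exp t_j - 1))`. -/
theorem sum_exp_neg_finsupp_le (t : ℕ → ℝ) (ht : ∀ j, 0 < t j)
    (hsum : Summable fun j => 1 / (Real.exp (t j) - 1)) (G : Finset (ℕ →₀ ℕ)) :
    ∑ s ∈ G, Real.exp (-(s.sum fun j c => t j * c)) ≤
      Real.exp (∑' j, 1 / (Real.exp (t j) - 1)) := by
  classical
  obtain ⟨J, hJ⟩ : ∃ J, ∀ s ∈ G, s.support ⊆ Finset.range J := by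
    obtain ⟨J, hJ⟩ := Finset.exists_nat_subset_range (G.biUnion Finsupp.support)
    exact ⟨J, fun s hs => (Finset.subset_biUnion_of_mem Finsupp.support hs).trans hJ⟩
  obtain ⟨C, hC⟩ : ∃ C, ∀ s ∈ G, ∀ j : Fin J, s j ∈ Finset.range C := by
    obtain ⟨C, hC⟩ := Finset.exists_nat_subset_range
      (G.biUnion fun s => Finset.univ.image fun j : Fin J => s j)
    exact ⟨C, fun s hs j => hC <| Finset.mem_biUnion.2
      ⟨s, hs, Finset.mem_image_of_mem _ (Finset.mem_univ j)⟩⟩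
  have hpos : ∀ j, 0 < Real.exp (t j) - 1 := fun j => by
    linarith [Real.add_one_lt_exp (ht j).ne', ht j]
  have hgeom : ∀ j, ∑ c ∈ Finset.range C, Real.exp (-t j) ^ c ≤
      Real.exp (1 / (Real.exp (t j) - 1)) := by
    intro j
    have hq : Real.exp (-t j) < 1 := Real.exp_lt_one_iff.2 (neg_neg_of_pos (ht j))
    calc ∑ c ∈ Finset.range C, Real.exp (-t j) ^ c ≤ ∑' c, Real.exp (-t j) ^ c :=
          (summable_geometric_of_lt_one (Real.exp_pos _).le hq).sum_le_tsum _
            fun c _ => by positivity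
      _ = (1 - Real.exp (-t j))⁻¹ := tsum_geometric_of_lt_one (Real.exp_pos _).le hq
      _ = 1 / (Real.exp (t j) - 1) + 1 := by
          have := hpos j
          have h1 : 1 - Real.exp (-t j) = (Real.exp (t j) - 1) / Real.exp (t j) := by
            rw [Real.exp_neg]
            field_simp
          rw [h1, inv_div]
          field_simp
          ring
      _ ≤ _ := Real.add_one_le_exp _
  have hterm : ∀ s ∈ G, Real.exp (-(s.sum fun j c => t j * c)) =
      ∏ j : Fin J, Real.exp (-t j) ^ s j := by
    intro s hs
    rw [Finsupp.sum_of_support_subset s (hJ s hs) _ (by simp), ← Finset.sum_neg_distrib,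
      Real.exp_sum, Finset.prod_range]
    refine Finset.prod_congr rfl fun j _ => ?_
    rw [← Real.exp_nat_mul]
    ring_nf
  have hinj : Set.InjOn (fun (s : ℕ →₀ ℕ) (j : Fin J) => s j) G := by
    intro s hs s' hs' h
    ext j
    by_cases hj : j < J
    · exact congrFun h ⟨j, hj⟩
    · have h0 : ∀ u ∈ G, u j = 0 := fun u hu => by
        by_contra hne
        exact hj (Finset.mem_range.1 (hJ u hu (Finsupp.mem_support_iff.2 hne)))
      rw [h0 s hs, h0 s' hs']
  calc ∑ s ∈ G, Real.exp (-(s.sum fun j c => t j * c))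
      = ∑ s ∈ G, ∏ j : Fin J, Real.exp (-t j) ^ s j := Finset.sum_congr rfl hterm
    _ = ∑ x ∈ G.image (fun (s : ℕ →₀ ℕ) (j : Fin J) => s j),
          ∏ j : Fin J, Real.exp (-t j) ^ x j :=
        (Finset.sum_image (f := fun x => ∏ j : Fin J, Real.exp (-t j) ^ x j) hinj).symm
    _ ≤ ∑ x ∈ Fintype.piFinset fun _ : Fin J => Finset.range C,
          ∏ j : Fin J, Real.exp (-t j) ^ x j := by
        refine Finset.sum_le_sum_of_subset_of_nonneg (fun x hx => ?_) fun x _ _ => by positivity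
        obtain ⟨s, hs, rfl⟩ := Finset.mem_image.1 hx
        exact Fintype.mem_piFinset.2 (hC s hs)
    _ = ∏ j : Fin J, ∑ c ∈ Finset.range C, Real.exp (-t j) ^ c :=
        (Finset.prod_univ_sum _ _).symm
    _ ≤ ∏ j : Fin J, Real.exp (1 / (Real.exp (t j) - 1)) :=
        Finset.prod_le_prod (fun j _ => by positivity) fun j _ => hgeom j
    _ = Real.exp (∑ j ∈ Finset.range J, 1 / (Real.exp (t j) - 1)) := by
        rw [Real.exp_sum, Finset.prod_range]
    _ ≤ _ := Real.exp_le_exp.2 <|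
        hsum.sum_le_tsum _ fun j _ => one_div_nonneg.2 (hpos j).le

/-- A finite set of indices of weight at most `1/ε` has at most
`exp (M₀(m)) ε^{-m/(α-β)}` elements. -/
theorem card_le_of_saWeight_le {m : ℕ} (hm : 1 ≤ m) {α β : ℝ} (hαβ : β < α) {r : ℕ → ℝ}
    (hrpos : ∀ j, 0 < r j)
    (hsum : Summable fun j : ℕ => 1 / (Real.exp ((m : ℝ) * r j / (α - β)) - 1))
    {ε : ℝ} (hε0 : 0 < ε) (F : Finset (SAIndex m))
    (hF : ∀ i ∈ F, ε * saWeight m α β r i ≤ 1) :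
    (F.card : ℝ) ≤ Real.exp (∑' j : ℕ, 1 / (Real.exp ((m : ℝ) * r j / (α - β)) - 1)) *
      ε ^ (-(m : ℝ) / (α - β)) := by
  classical
  have ha : 0 < α - β := sub_pos.2 hαβ
  have hm0 : (0 : ℝ) < m := by exact_mod_cast hm
  let X : (ℕ →₀ ℕ) → ℝ := fun s => s.sum fun j c => r j * c
  let R : (ℕ →₀ ℕ) → ℝ := fun s => ε ^ (-1 / (α - β)) * Real.exp (-X s / (α - β))
  have hR : ∀ s, 0 ≤ R s := fun s => by positivity
  have hfiber : ∀ s, ((F.filter fun i => i.2 = s).card : ℝ) ≤ R s ^ m := by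
    intro s
    have hcard : (F.filter fun i => i.2 = s).card ≤
        (Fintype.piFinset fun _ : Fin m => Finset.range ⌊R s⌋₊).card := by
      refine Finset.card_le_card_of_injOn Prod.fst (fun i hi => ?_) fun i hi i' hi' h => ?_
      · obtain ⟨hiF, rfl⟩ := Finset.mem_filter.1 hi
        refine Fintype.mem_piFinset.2 fun j => Finset.mem_range.2 ?_
        have hle : 1 + i.1 j ≤ Finset.univ.sup (fun j => 1 + i.1 j) :=
          Finset.le_sup (f := fun j => 1 + i.1 j) (Finset.mem_univ j)
        refine Nat.lt_of_lt_of_le (Nat.lt_one_add_iff.2 le_rfl) (hle.trans (Nat.le_floor ?_))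
        set N : ℕ := Finset.univ.sup (fun j => 1 + i.1 j)
        have hw : (N : ℝ) ^ (α - β) ≤ ε⁻¹ * Real.exp (-X i.2) := by
          have h1 : ε * ((N : ℝ) ^ (α - β) * Real.exp (X i.2)) ≤ 1 := hF i hiF
          rw [Real.exp_neg, ← mul_inv, ← one_div, le_div_iff₀ (by positivity)]
          linarith
        have h2 := Real.rpow_le_rpow (by positivity) hw (inv_nonneg.2 ha.le)
        rw [Real.rpow_rpow_inv (Nat.cast_nonneg _) ha.ne',
          Real.mul_rpow (by positivity) (by positivity), ← Real.exp_mul, Real.inv_rpow hε0.le,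
          ← Real.rpow_neg hε0.le] at h2
        simpa only [R, div_eq_mul_inv, neg_one_mul] using h2
      · exact Prod.ext h ((Finset.mem_filter.1 hi).2.trans (Finset.mem_filter.1 hi').2.symm)
    rw [Fintype.card_piFinset_const, Finset.card_range] at hcard
    calc ((F.filter fun i => i.2 = s).card : ℝ) ≤ (⌊R s⌋₊ : ℝ) ^ m := by exact_mod_cast hcard
      _ ≤ R s ^ m := pow_le_pow_left₀ (Nat.cast_nonneg _) (Nat.floor_le (hR s)) m
  have hRpow : ∀ s, R s ^ m = ε ^ (-(m : ℝ) / (α - β)) *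
      Real.exp (-(s.sum fun j c => (m : ℝ) * r j / (α - β) * c)) := by
    intro s
    rw [mul_pow, ← Real.rpow_mul_natCast hε0.le, ← Real.exp_nat_mul]
    congr 2
    · ring
    · simp only [X, Finsupp.sum, ← Finset.sum_neg_distrib, Finset.sum_div, Finset.mul_sum]
      exact Finset.sum_congr rfl fun j _ => by ring
  have hbound := sum_exp_neg_finsupp_le (fun j => (m : ℝ) * r j / (α - β))
    (fun j => div_pos (mul_pos hm0 (hrpos j)) ha) hsum (F.image Prod.snd)
  calc (F.card : ℝ) = ∑ s ∈ F.image Prod.snd, ((F.filter fun i => i.2 = s).card : ℝ) := by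
        rw [Finset.card_eq_sum_card_image Prod.snd F, Nat.cast_sum]
    _ ≤ ∑ s ∈ F.image Prod.snd, R s ^ m := Finset.sum_le_sum fun s _ => hfiber s
    _ = ε ^ (-(m : ℝ) / (α - β)) * ∑ s ∈ F.image Prod.snd,
          Real.exp (-(s.sum fun j c => (m : ℝ) * r j / (α - β) * c)) := by
        rw [Finset.mul_sum]
        exact Finset.sum_congr rfl fun s _ => hRpow s
    _ ≤ _ := by
        rw [mul_comm]
        exact mul_le_mul_of_nonneg_right hbound (by positivity)

/-- A set all of whose finite subsets have cardinality at most `B` is finite. -/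
theorem Set.finite_of_forall_finset_card_le {ι : Type*} {s : Set ι} {B : ℝ}
    (h : ∀ F : Finset ι, (F : Set ι) ⊆ s → (F.card : ℝ) ≤ B) : s.Finite := by
  by_contra hinf
  obtain ⟨F, hFs, hF⟩ := Set.Infinite.exists_subset_card_eq hinf (⌊B⌋₊ + 1)
  have h1 := h F hFs
  rw [hF] at h1
  push_cast at h1
  linarith [Nat.lt_floor_add_one B]

/-- **Main ε-dimension theorem (Sobolev-analytic case, `p = 0`).**
Let `m ≥ 1`, `α > β ≥ 0`, `a = α - β`, and let `r` be positive with
`M₀(m) = ∑_j 1/(e^{m r_j/a} - 1) < ∞`. Then for every `ε ∈ (0,1]`: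
(i) some submodule `M` of `ℓ²` with `dim M ≤ (3/2)^{2m} exp(M₀(m)) ε^{-m/(α-β)}`
approximates every `g` of the `w`-weighted unit ball within `ε`; and
(ii) every submodule of dimension `≤ ⌊ε^{-1/(α-β)}⌋^m - 2` fails to do so, i.e.
the sup over the ball of the `ℓ²`-distance to it is `≥ ε`. -/
theorem epsilon_dimension_sobolev_analytic (m : ℕ) (hm : 1 ≤ m) (α β : ℝ)
    (hβ : 0 ≤ β) (hαβ : β < α) (r : ℕ → ℝ) (hrpos : ∀ j, 0 < r j)
    (hsum : Summable fun j : ℕ => 1 / (Real.exp ((m : ℝ) * r j / (α - β)) - 1))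
    (ε : ℝ) (hε0 : 0 < ε) (hε1 : ε ≤ 1) :
    (∃ M : Submodule ℂ (lp (fun _ : SAIndex m => ℂ) 2),
      FiniteDimensional ℂ M ∧
      (Module.finrank ℂ M : ℝ) ≤
        (3/2 : ℝ) ^ (2 * m) *
          Real.exp (∑' j : ℕ, 1 / (Real.exp ((m : ℝ) * r j / (α - β)) - 1)) *
          ε ^ (-(m : ℝ) / (α - β)) ∧
      ∀ g : lp (fun _ : SAIndex m => ℂ) 2,
        (∑' i : SAIndex m, ENNReal.ofReal ((saWeight m α β r i) ^ 2 * ‖g i‖ ^ 2)) ≤ 1 →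
        (⨅ h : M, ‖g - (h : lp (fun _ : SAIndex m => ℂ) 2)‖) ≤ ε) ∧
    (∀ M : Submodule ℂ (lp (fun _ : SAIndex m => ℂ) 2),
      FiniteDimensional ℂ M →
      Module.finrank ℂ M ≤ ⌊ε ^ (-1 / (α - β))⌋₊ ^ m - 2 →
      ∃ g : lp (fun _ : SAIndex m => ℂ) 2,
        (∑' i : SAIndex m, ENNReal.ofReal ((saWeight m α β r i) ^ 2 * ‖g i‖ ^ 2)) ≤ 1 ∧
        ε ≤ ⨅ h : M, ‖g - (h : lp (fun _ : SAIndex m => ℂ) 2)‖) := by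
  have ha : 0 < α - β := sub_pos.2 hαβ
  constructor
  · have hcard := card_le_of_saWeight_le hm hαβ hrpos hsum hε0
    have hfin : {i | ε * saWeight m α β r i ≤ 1}.Finite :=
      Set.finite_of_forall_finset_card_le fun F hF => hcard F fun i hi => hF hi
    obtain ⟨M, hM, hMcard, hMapprox⟩ := exists_submodule_approx_weighted_ball
      (saWeight m α β r) hε0 hfin.toFinset fun i hi => by
        rw [Set.Finite.mem_toFinset, Set.mem_ofPred_eq, not_le] at hi
        exact hi.le
    refine ⟨M, hM, ?_, hMapprox⟩
    calc (Module.finrank ℂ M : ℝ) ≤ hfin.toFinset.card := by exact_mod_cast hMcard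
      _ ≤ _ := hcard _ fun i hi => hfin.mem_toFinset.1 hi
      _ ≤ _ := by
        rw [mul_assoc]
        exact le_mul_of_one_le_left (by positivity) (one_le_pow₀ (by norm_num))
  · intro M _ hM
    set T : ℝ := ε ^ (-1 / (α - β)) with hT
    have hT1 : 1 ≤ T := Real.one_le_rpow_of_pos_of_le_one_of_nonpos hε0 hε1
      (div_nonpos_of_nonpos_of_nonneg (by norm_num) ha.le)
    have hN : 1 ≤ ⌊T⌋₊ ^ m := Nat.one_le_pow _ _ (Nat.floor_pos.2 hT1)
    refine exists_mem_weighted_ball_le_dist (saWeight m α β r) hε0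
      ((Fintype.piFinset fun _ : Fin m => Finset.range ⌊T⌋₊) ×ˢ {0})
      (fun i _ => by unfold saWeight; positivity) (fun i hi => ?_) M ?_
    · obtain ⟨hk, hs⟩ := Finset.mem_product.1 hi
      have hsup : Finset.univ.sup (fun j => 1 + i.1 j) ≤ ⌊T⌋₊ := Finset.sup_le fun j _ => by
        have := Finset.mem_range.1 (Fintype.mem_piFinset.1 hk j)
        omega
      have hle : ((Finset.univ.sup (fun j => 1 + i.1 j) : ℕ) : ℝ) ≤ T :=
        (Nat.cast_le.2 hsup).trans (Nat.floor_le (zero_le_one.trans hT1))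
      have hTpow : T ^ (α - β) = ε⁻¹ := by
        rw [hT, ← Real.rpow_mul hε0.le, div_mul_cancel₀ _ ha.ne', Real.rpow_neg_one]
      have hpow := Real.rpow_le_rpow (Nat.cast_nonneg _) hle ha.le
      rw [hTpow] at hpow
      rw [saWeight, Finset.mem_singleton.1 hs, Finsupp.sum_zero_index, Real.exp_zero, mul_one]
      calc _ ≤ ε * ε⁻¹ := mul_le_mul_of_nonneg_left hpow hε0.le
        _ = 1 := mul_inv_cancel₀ hε0.ne'
    · rw [Finset.card_product, Fintype.card_piFinset_const, Finset.card_range,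
        Finset.card_singleton]
      omega
end
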